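/- For any polynomial-time Turing machine M, there exists a program in SAFE₀ that computes the same function as M. -/

import Mathlib

set_option maxHeartbeats 1000000

/-! ## Words -/

/-- Words over the alphabet `Σ = {0,1}` (`false` = `0`, `true` = `1`). -/
abbrev Wd := List Bool

/-- `v ⊴ w` : `v` is a subword of `w`. -/
def Subword (v w : Wd) : Prop := ∃ u u' : Wd, w = u ++ v ++ u'

/-- `v ↾ n` : truncation of `v` to its first `min n |v|` symbols, then padding with a
word of the form `1·0^k` so that the result has length exactly `n+1`. -/
def truncN (v : Wd) (n : ℕ) : Wd :=
  v.take n ++ [true] ++ List.replicate (n - (v.take n).length) false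

/-- The semantics `⟦↾⟧(v,w) = v ↾ |w|` of the truncation-padding operator. -/
def truncW (v w : Wd) : Wd := truncN v w.length

/-- `lmin(a,b)` : the length-minimum of two words. -/
def lminW (a b : Wd) : Wd := if a.length < b.length then a else b

/-- Kapron-Steinberg's bounded iterator `I'`. -/
def Iprime (F : Wd → Wd) (a b c : Wd) : Wd := (fun x => F (lminW x a))^[c.length] b

/-- Encoding of a tuple of words as a single word. -/
def encTuple (ws : List Wd) : Wd :=
  (ws.map (fun w => (w.flatMap fun b => [true, b]) ++ [false, false])).flatten

/-! ## Simple types over `W` and functionals -/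

/-- Simple types over the base type `W` of words. -/
inductive Ty where
  | W : Ty
  | arrow : Ty → Ty → Ty
deriving DecidableEq, Repr

/-- Set-theoretic interpretation of a simple type. -/
def Ty.interp : Ty → Type
  | .W => Wd
  | .arrow a b => a.interp → b.interp

/-- The order of a simple type. -/
def Ty.order : Ty → ℕ
  | .W => 0
  | .arrow a b => max (a.order + 1) b.order

/-- A functional of simple type over `W`. -/
def Functional : Type := Σ T : Ty, T.interp

/-- The type `W → ⋯ → W` (`l` arguments). -/
def ty1 : ℕ → Ty
  | 0 => .W
  | l + 1 => .arrow .W (ty1 l)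

/-- The type `(W→W) → ⋯ → (W→W) → W → ⋯ → W` (`k` order-1 arguments, `l` order-0 ones). -/
def ty2 : ℕ → ℕ → Ty
  | 0, l => ty1 l
  | k + 1, l => .arrow (.arrow .W .W) (ty2 k l)

def curry1 : (l : ℕ) → ((Fin l → Wd) → Wd) → (ty1 l).interp
  | 0, F => F (fun i => i.elim0)
  | l + 1, F => fun w => curry1 l (fun ws => F (Fin.cons w ws))

def curry2 : (k l : ℕ) → ((Fin k → (Wd → Wd)) → (Fin l → Wd) → Wd) → (ty2 k l).interp
  | 0, l, F => curry1 l (F (fun i => i.elim0))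
  | k + 1, l, F => fun f => curry2 k l (fun fs => F (Fin.cons f fs))

def curryList : (n : ℕ) → (List Wd → Wd) → (ty1 n).interp :=
  fun n g => curry1 n (fun ws => g (List.ofFn ws))

/-- Types of second-order functionals, in the normalized shape `(W→W)^k → W^l → W`. -/
def IsTy2 (T : Ty) : Prop := ∃ k l, T = ty2 k l

/-- Restriction of a set of functionals to the second-order ones. -/
def restrict2 (S : Set Functional) : Set Functional := { F ∈ S | IsTy2 F.1 }

/-! ## Simply-typed lambda closure -/

/-- Simply-typed lambda terms (de Bruijn style) with constants from a set `S` of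
functionals of simple type over `W`. -/
inductive STLC (S : Set Functional) : List Ty → Ty → Type where
  | const {Γ : List Ty} (F : Functional) (h : F ∈ S) : STLC S Γ F.1
  | var {Γ : List Ty} (i : Fin Γ.length) : STLC S Γ (Γ.get i)
  | abs {Γ : List Ty} {T T' : Ty} : STLC S (T :: Γ) T' → STLC S Γ (.arrow T T')
  | app {Γ : List Ty} {T T' : Ty} : STLC S Γ (.arrow T T') → STLC S Γ T → STLC S Γ T'

/-- Interpretation of typing contexts. -/
def EnvI : List Ty → Type
  | [] => PUnit
  | T :: Γ => T.interp × EnvI Γ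

def lookupE : {Γ : List Ty} → (i : Fin Γ.length) → EnvI Γ → (Γ.get i).interp
  | _ :: _, ⟨0, _⟩, ρ => ρ.1
  | _ :: Γ, ⟨i + 1, h⟩, ρ => lookupE (Γ := Γ) ⟨i, Nat.lt_of_succ_lt_succ h⟩ ρ.2

/-- Denotational semantics of simply-typed lambda terms. -/
def STLC.denote {S : Set Functional} : {Γ : List Ty} → {T : Ty} → STLC S Γ T → EnvI Γ → T.interp
  | _, _, .const F _, _ => F.2
  | _, _, .var i, ρ => lookupE i ρ
  | _, _, .abs t, ρ => fun v => t.denote (v, ρ)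
  | _, _, .app t s, ρ => (t.denote ρ) (s.denote ρ)

/-- `λ(S)` : the set of functionals denoted by closed simply-typed lambda terms with
constants from `S`. -/
def lambdaClosure (S : Set Functional) : Set Functional :=
  fun G => ∃ t : STLC S [] G.1, t.denote PUnit.unit = G.2

/-- `λ(S)₂` : the second-order simply-typed lambda closure of `S`. -/
def lambdaClosure2 (S : Set Functional) : Set Functional := restrict2 (lambdaClosure S)
/-! ## Operators

A fixed suite of operators, indexed by natural numbers:
`0 = ε`, `1 = pred`, `2 = suc₀`, `3 = suc₁`, `4 = head`, `5 = ==`, `6 = !=`, `7 = lmin`;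
every other index denotes the (neutral) constant-`ε` operator. -/

def opArity : ℕ → ℕ
  | 0 => 0
  | 1 => 1 | 2 => 1 | 3 => 1 | 4 => 1
  | 5 => 2 | 6 => 2 | 7 => 2
  | _ => 0

def opSem : ℕ → List Wd → Wd
  | 0, _ => []
  | 1, ws => (ws.getD 0 []).tail
  | 2, ws => false :: ws.getD 0 []
  | 3, ws => true :: ws.getD 0 []
  | 4, ws => (ws.getD 0 []).take 1
  | 5, ws => [decide (ws.getD 0 [] = ws.getD 1 [])]
  | 6, ws => [decide (ws.getD 0 [] ≠ ws.getD 1 [])]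
  | 7, ws => lminW (ws.getD 0 []) (ws.getD 1 [])
  | _, _ => []

/-- A neutral operator: constant (of arity 0), a `{0,1}`-valued predicate, or an operator
whose output is always a subword of one of its inputs. -/
def NeutralOp (o : ℕ) : Prop :=
  opArity o = 0 ∨ (∀ ws, opSem o ws = [false] ∨ opSem o ws = [true]) ∨
    (∀ ws : List Wd, ws.length = opArity o → ∃ w ∈ ws, Subword (opSem o ws) w)

/-- A positive operator: the output length exceeds the maximal input length by at most a
constant. -/
def PositiveOp (o : ℕ) : Prop :=
  ∃ c : ℕ, ∀ ws : List Wd, (opSem o ws).length ≤ (ws.map List.length).foldr max 0 + c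

/-! ## Syntax of the programming language -/

/-- Variables: type-0 variables `v0 x`, type-1 variables `v1 X`, higher-order variables
`vh a`. -/
inductive Var where
  | v0 : ℕ → Var
  | v1 : ℕ → Var
  | vh : ℕ → Var
deriving DecidableEq

/-- Expressions. `oracleCall X e₁ e₂` is the oracle call `X(e₁ ↾ e₂)`. -/
inductive Expr where
  | var : ℕ → Expr
  | op : ℕ → List Expr → Expr
  | oracleCall : ℕ → Expr → Expr → Expr

/-- Statements. -/
inductive Stmt where
  | skip : Stmt
  | assign : ℕ → Expr → Stmt
  | seq : Stmt → Stmt → Stmt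
  | ite : Expr → Stmt → Stmt → Stmt
  | while : Expr → Stmt → Stmt

/-- Procedures `P(X̄, x̄){var ȳ; st return z}`. -/
structure Proc where
  name : ℕ
  oparams : List ℕ
  params : List ℕ
  locals : List ℕ
  body : Stmt
  ret : ℕ

/-- Terms.  A closure `{x → t}` is represented as the pair `(x, t)`. -/
inductive Tm where
  | var : Var → Tm
  | lam : Var → Tm → Tm
  | app : Tm → Tm → Tm
  | call : ℕ → List (ℕ × Tm) → List Tm → Tm

/-- Programs. -/
inductive Prog where
  | term : Tm → Prog
  | declare : List Proc → Prog → Prog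
  | box : Var → Prog → Prog

def mkBoxes (as : List Var) (p : Prog) : Prog := as.foldr .box p

/-- The list of procedures declared in a program. -/
def procsOf : Prog → List Proc
  | .term _ => []
  | .declare ps p => ps ++ procsOf p
  | .box _ p => procsOf p

/-- Substitution `t[s/a]` on terms. -/
def Tm.subst (a : Var) (s : Tm) : Tm → Tm
  | .var b => if b = a then s else .var b
  | .lam b t => if b = a then .lam b t else .lam b (Tm.subst a s t)
  | .app t1 t2 => .app (Tm.subst a s t1) (Tm.subst a s t2)
  | .call P cs ts =>
      .call P
        (cs.attach.map fun c => (c.1.1, if Var.v0 c.1.1 = a then c.1.2 else Tm.subst a s c.1.2))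
        (ts.attach.map fun t => Tm.subst a s t.1)
decreasing_by all_goals
  first
  | (simp only [Tm.lam.sizeOf_spec, Tm.app.sizeOf_spec]; omega)
  | (have h := List.sizeOf_lt_of_mem c.2
     rcases c with ⟨⟨cx, ct⟩, hc⟩
     simp only [Tm.call.sizeOf_spec, Prod.mk.sizeOf_spec] at *
     omega)
  | (have h := List.sizeOf_lt_of_mem t.2
     simp only [Tm.call.sizeOf_spec]; omega)

/-! ## Program sizes -/

def Expr.size : Expr → ℕ
  | .var _ => 1
  | .op _ args => 1 + (args.attach.map (fun e => e.1.size)).sum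
  | .oracleCall _ e1 e2 => 2 + e1.size + e2.size
decreasing_by all_goals
  first
  | (simp only [Expr.oracleCall.sizeOf_spec]; omega)
  | (have h := List.sizeOf_lt_of_mem e.2
     simp only [Expr.op.sizeOf_spec]; omega)

def Stmt.size : Stmt → ℕ
  | .skip => 1
  | .assign _ e => 2 + e.size
  | .seq s1 s2 => 1 + s1.size + s2.size
  | .ite e s1 s2 => 1 + e.size + s1.size + s2.size
  | .while e s => 1 + e.size + s.size

def Tm.size : Tm → ℕ
  | .var _ => 1
  | .lam _ t => 2 + t.size
  | .app t1 t2 => 1 + t1.size + t2.size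
  | .call _ cs ts =>
      2 + (cs.attach.map (fun c => 2 + c.1.2.size)).sum + (ts.attach.map (fun t => t.1.size)).sum
decreasing_by all_goals
  first
  | (simp only [Tm.lam.sizeOf_spec, Tm.app.sizeOf_spec]; omega)
  | (have h := List.sizeOf_lt_of_mem c.2
     rcases c with ⟨⟨cx, ct⟩, hc⟩
     simp only [Tm.call.sizeOf_spec, Prod.mk.sizeOf_spec] at *
     omega)
  | (have h := List.sizeOf_lt_of_mem t.2
     simp only [Tm.call.sizeOf_spec]; omega)

def Proc.size (p : Proc) : ℕ :=
  2 + p.oparams.length + p.params.length + p.locals.length + p.body.size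

/-- The size `|prg|` of a program: the total number of symbols in `prg`. -/
def Prog.size : Prog → ℕ
  | .term t => t.size
  | .declare ps p => 1 + (ps.map Proc.size).sum + p.size
  | .box _ p => 2 + p.size

/-! ## Encoding of programs as words -/

def encNat (n : ℕ) : Wd := List.replicate n true ++ [false]

def Expr.enc : Expr → Wd
  | .var x => [false, false] ++ encNat x
  | .op o args => [false, true] ++ encNat o ++ encNat args.length
      ++ (args.attach.map (fun e => e.1.enc)).flatten
  | .oracleCall X e1 e2 => [true, false] ++ encNat X ++ e1.enc ++ e2.enc
decreasing_by all_goals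
  first
  | (simp only [Expr.oracleCall.sizeOf_spec]; omega)
  | (have h := List.sizeOf_lt_of_mem e.2
     simp only [Expr.op.sizeOf_spec]; omega)

def Stmt.enc : Stmt → Wd
  | .skip => [false, false, false]
  | .assign x e => [false, false, true] ++ encNat x ++ e.enc
  | .seq s1 s2 => [false, true, false] ++ s1.enc ++ s2.enc
  | .ite e s1 s2 => [false, true, true] ++ e.enc ++ s1.enc ++ s2.enc
  | .while e s => [true, false, false] ++ e.enc ++ s.enc

def Proc.enc (p : Proc) : Wd :=
  encNat p.name ++ encNat p.oparams.length ++ (p.oparams.map encNat).flatten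
    ++ encNat p.params.length ++ (p.params.map encNat).flatten
    ++ encNat p.locals.length ++ (p.locals.map encNat).flatten
    ++ p.body.enc ++ encNat p.ret

def Var.enc : Var → Wd
  | .v0 x => [false] ++ encNat x
  | .v1 X => [true, false] ++ encNat X
  | .vh a => [true, true] ++ encNat a

def Tm.enc : Tm → Wd
  | .var a => [false, false] ++ a.enc
  | .lam a t => [false, true] ++ a.enc ++ t.enc
  | .app t1 t2 => [true, false] ++ t1.enc ++ t2.enc
  | .call P cs ts => [true, true] ++ encNat P ++ encNat cs.length
      ++ (cs.attach.map (fun c => encNat c.1.1 ++ c.1.2.enc)).flatten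
      ++ encNat ts.length ++ (ts.attach.map (fun t => t.1.enc)).flatten
decreasing_by all_goals
  first
  | (simp only [Tm.lam.sizeOf_spec, Tm.app.sizeOf_spec]; omega)
  | (have h := List.sizeOf_lt_of_mem c.2
     rcases c with ⟨⟨cx, ct⟩, hc⟩
     simp only [Tm.call.sizeOf_spec, Prod.mk.sizeOf_spec] at *
     omega)
  | (have h := List.sizeOf_lt_of_mem t.2
     simp only [Tm.call.sizeOf_spec]; omega)

/-- A standard binary encoding of programs. -/
def Prog.enc : Prog → Wd
  | .term t => [false] ++ t.enc
  | .declare ps p => [true, false] ++ encNat ps.length ++ (ps.map Proc.enc).flatten ++ p.enc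
  | .box a p => [true, true] ++ a.enc ++ p.enc
/-! ## Operational semantics -/

/-- A store: a pair of finite partial maps assigning words to type-0 variables and
total functions on words to type-1 variables. -/
structure Store where
  w : ℕ → Option Wd
  o : ℕ → Option (Wd → Wd)

def Store.updW0 (μ : Store) (x : ℕ) (v : Wd) : Store :=
  ⟨fun y => if y = x then some v else μ.w y, μ.o⟩

def Store.updWs (μ : Store) (xs : List ℕ) (vs : List Wd) : Store :=
  (xs.zip vs).foldl (fun m p => m.updW0 p.1 p.2) μ

/-- `a ∈ dom(μ)`. -/
def StoreDefined (μ : Store) : Var → Prop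
  | .v0 x => (μ.w x).isSome
  | .v1 X => (μ.o X).isSome
  | .vh _ => False

/-- Continuations: maps from type-1 variables to closures. -/
def Cnt : Type := ℕ → Option (ℕ × Tm)

/-- The continuation `X̄ ↦ c̄`. -/
def contOf (Xs : List ℕ) (cs : List (ℕ × Tm)) : Cnt :=
  fun X => ((Xs.zip cs).find? (fun q => q.1 == X)).map (·.2)

/-- Values of the call-by-name reduction on terms. -/
inductive IsVal : Tm → Prop
  | var0 (x : ℕ) : IsVal (.var (.v0 x))
  | lam (a : Var) (t : Tm) : IsVal (.lam a t)
  | oapp (X : ℕ) (t : Tm) : IsVal (.app (.var (.v1 X)) t)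
  | call (P : ℕ) (cs : List (ℕ × Tm)) (ts : List Tm) : IsVal (.call P cs ts)

/-- Big-step call-by-name reduction `t ↓ v` on terms. -/
inductive BigStep : Tm → Tm → Prop
  | val {t : Tm} : IsVal t → BigStep t t
  | app {t1 t2 t v : Tm} {a : Var} :
      BigStep t1 (.lam a t) → BigStep (Tm.subst a t2 t) v → BigStep (.app t1 t2) v

mutual
/-- `(σ, μ, φ, e) →exp w`. -/
inductive EvalExpr : List Proc → Store → Cnt → Expr → Wd → Prop
  | var {σ μ φ x v} : μ.w x = some v → EvalExpr σ μ φ (.var x) v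
  | op {σ μ φ o args} (ws : List Wd) :
      args.length = opArity o → ws.length = args.length →
      (∀ (i : ℕ) (e : Expr) (w : Wd), args[i]? = some e → ws[i]? = some w → EvalExpr σ μ φ e w) →
      EvalExpr σ μ φ (.op o args) (opSem o ws)
  | orc {σ μ φ X e1 e2 v u x t w} :
      EvalExpr σ μ φ e1 v → EvalExpr σ μ φ e2 u → φ X = some (x, t) →
      EvalTm σ (μ.updW0 x (truncW v u)) t w →
      EvalExpr σ μ φ (.oracleCall X e1 e2) w

/-- `(σ, μ, φ, st) →st μ'`. -/
inductive EvalStmt : List Proc → Store → Cnt → Stmt → Store → Prop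
  | skip {σ μ φ} : EvalStmt σ μ φ .skip μ
  | asg {σ μ φ x e w} : EvalExpr σ μ φ e w → EvalStmt σ μ φ (.assign x e) (μ.updW0 x w)
  | seq {σ μ φ s1 s2 μ' μ''} :
      EvalStmt σ μ φ s1 μ' → EvalStmt σ μ' φ s2 μ'' → EvalStmt σ μ φ (.seq s1 s2) μ''
  | condT {σ μ φ e s1 s0 μ'} :
      EvalExpr σ μ φ e [true] → EvalStmt σ μ φ s1 μ' → EvalStmt σ μ φ (.ite e s1 s0) μ'
  | condF {σ μ φ e s1 s0 μ'} :
      EvalExpr σ μ φ e [false] → EvalStmt σ μ φ s0 μ' → EvalStmt σ μ φ (.ite e s1 s0) μ'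
  | whF {σ μ φ e s} : EvalExpr σ μ φ e [false] → EvalStmt σ μ φ (.while e s) μ
  | whT {σ μ φ e s μ'} :
      EvalExpr σ μ φ e [true] → EvalStmt σ μ φ (.seq s (.while e s)) μ' →
      EvalStmt σ μ φ (.while e s) μ'

/-- `(σ, μ, t) →env w` for type-0 terms. -/
inductive EvalTm : List Proc → Store → Tm → Wd → Prop
  | tvar {σ μ t x v} : BigStep t (.var (.v0 x)) → μ.w x = some v → EvalTm σ μ t v
  | oa {σ μ t X t1 w f} :
      BigStep t (.app (.var (.v1 X)) t1) → EvalTm σ μ t1 w → μ.o X = some f →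
      EvalTm σ μ t (f w)
  | call {σ μ t P cs ts p μ' v} (ws : List Wd) :
      BigStep t (.call P cs ts) → p ∈ σ → p.name = P →
      cs.length = p.oparams.length → ts.length = p.params.length →
      ws.length = ts.length →
      (∀ (i : ℕ) (t1 : Tm) (w : Wd), ts[i]? = some t1 → ws[i]? = some w → EvalTm σ μ t1 w) →
      EvalStmt σ ((μ.updWs p.params ws).updWs p.locals (List.replicate p.locals.length []))
        (contOf p.oparams cs) p.body μ' →
      μ'.w p.ret = some v →
      EvalTm σ μ t v
end

/-- `(σ, μ, prg) →env w` for programs. -/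
inductive EvalProg : List Proc → Store → Prog → Wd → Prop
  | term {σ μ t v} : EvalTm σ μ t v → EvalProg σ μ (.term t) v
  | dec {σ μ ps prg v} : EvalProg (σ ++ ps) μ prg v → EvalProg σ μ (.declare ps prg) v
  | box {σ μ a prg v} : StoreDefined μ a → EvalProg σ μ prg v → EvalProg σ μ (.box a prg) v

/-- The initial store mapping the boxed variables `X̄` and `x̄` to the inputs. -/
def initStore (Xs xs : List ℕ) (fl : List (Wd → Wd)) (wl : List Wd) : Store :=
  ⟨fun x => (xs.findIdx? (fun y => y == x)).bind (fun i => wl[i]?),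
   fun X => (Xs.findIdx? (fun y => y == X)).bind (fun i => fl[i]?)⟩

/-- A closed program in normal form: `box[X̄, x̄] in declare p̄ in t`. -/
def IsNF (prg : Prog) : Prop :=
  ∃ (Xs xs : List ℕ) (ps : List Proc) (t : Tm), Xs.Nodup ∧ xs.Nodup ∧
    prg = mkBoxes (Xs.map Var.v1 ++ xs.map Var.v0) (.declare ps (.term t))

/-- `prg` is a closed program in normal form computing the total second-order functional
`F : (W→W)^k → W^l → W`. -/
def computesTotal (prg : Prog) (k l : ℕ)
    (F : (Fin k → (Wd → Wd)) → (Fin l → Wd) → Wd) : Prop :=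
  ∃ (Xs xs : List ℕ) (ps : List Proc) (t : Tm),
    Xs.length = k ∧ xs.length = l ∧ Xs.Nodup ∧ xs.Nodup ∧
    prg = mkBoxes (Xs.map Var.v1 ++ xs.map Var.v0) (.declare ps (.term t)) ∧
    ∀ (fs : Fin k → (Wd → Wd)) (ws : Fin l → Wd),
      EvalProg [] (initStore Xs xs (List.ofFn fs) (List.ofFn ws)) prg (F fs ws)

/-- `SN` : the set of terminating programs, i.e. those whose computed second-order
functional is total. -/
def SN : Set Prog := { prg | ∃ k l F, computesTotal prg k l F }

/-- `⟦S⟧` : the set of (total second-order) functionals computed by the programs of `S`. -/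
def progFunSet (S : Set Prog) : Set Functional :=
  { G | ∃ prg ∈ S, ∃ k l F, computesTotal prg k l F ∧ G = ⟨ty2 k l, curry2 k l F⟩ }
/-! ## The tier-based type system -/

/-- Variable typing environments: tiers for type-0 variables. -/
def VEnv : Type := ℕ → Option ℕ

/-- Operator typing environments: `Δ op k_in` is a set of first-order tiers
`k₁ → ⋯ → kₙ → k'`, represented as pairs `(list of argument tiers, result tier)`. -/
def OTE : Type := ℕ → ℕ → Set (List ℕ × ℕ)

/-- Tier-based typing judgments `Γ, Δ ⊢ e : (k, k_in, k_out)` for expressions. -/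
inductive TyExpr (Γ : VEnv) (Δ : OTE) : Expr → ℕ × ℕ × ℕ → Prop
  | evar {x k kin kout} : Γ x = some k → TyExpr Γ Δ (.var x) (k, kin, kout)
  | eop {o args ks k kin kout} :
      (ks, k) ∈ Δ o kin → ks.length = args.length →
      (∀ (i : ℕ) (κ : ℕ) (e : Expr), ks[i]? = some κ → args[i]? = some e →
        TyExpr Γ Δ e (κ, kin, kout)) →
      TyExpr Γ Δ (.op o args) (k, kin, kout)
  | eor {X e1 e2 k kin kout} :
      TyExpr Γ Δ e1 (k, kin, kout) → TyExpr Γ Δ e2 (kout, kin, kout) →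
      k < kin → k ≤ kout →
      TyExpr Γ Δ (.oracleCall X e1 e2) (k, kin, kout)

/-- Tier-based typing judgments `Γ, Δ ⊢ st : (k, k_in, k_out)` for statements. -/
inductive TyStmt (Γ : VEnv) (Δ : OTE) : Stmt → ℕ × ℕ × ℕ → Prop
  | ssk {kin kout} : TyStmt Γ Δ .skip (0, kin, kout)
  | ssub {st k kin kout} : TyStmt Γ Δ st (k, kin, kout) → TyStmt Γ Δ st (k + 1, kin, kout)
  | sseq {s1 s2 k kin kout} :
      TyStmt Γ Δ s1 (k, kin, kout) → TyStmt Γ Δ s2 (k, kin, kout) →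
      TyStmt Γ Δ (.seq s1 s2) (k, kin, kout)
  | sasg {x e k1 k2 kin kout} :
      Γ x = some k1 → TyExpr Γ Δ e (k2, kin, kout) → k1 ≤ k2 →
      TyStmt Γ Δ (.assign x e) (k1, kin, kout)
  | scnd {e s1 s0 k kin kout} :
      TyExpr Γ Δ e (k, kin, kout) → TyStmt Γ Δ s1 (k, kin, kout) →
      TyStmt Γ Δ s0 (k, kin, kout) →
      TyStmt Γ Δ (.ite e s1 s0) (k, kin, kout)
  | swinit {e st k kin} :
      TyExpr Γ Δ e (k, kin, k) → TyStmt Γ Δ st (k, k, k) → 1 ≤ k →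
      TyStmt Γ Δ (.while e st) (k, kin, 0)
  | swh {e st k kin kout} :
      TyExpr Γ Δ e (k, kin, kout) → TyStmt Γ Δ st (k, k, kout) → 1 ≤ k → k ≤ kout →
      TyStmt Γ Δ (.while e st) (k, kin, kout)

/-- Simple typing environments. -/
def TEnv : Type := Var → Option Ty

def TEnv.upd (Γ : TEnv) (a : Var) (T : Ty) : TEnv :=
  fun b => if b = a then some T else Γ b

/-- Procedure typing environments: each procedure is assigned a variable typing
environment and a triplet of tiers. -/
def PEnv : Type := Proc → VEnv × (ℕ × ℕ × ℕ)

/-- Simple typing judgments for terms, with rank bound `R` on the simple types of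
lambda-abstractions.  `procs` is the list of procedures in scope. -/
inductive TyTm (R : WithTop ℕ) (Δ : OTE) (procs : List Proc) : TEnv → Tm → Ty → Prop
  | pvar {ΓW a T} : ΓW a = some T → TyTm R Δ procs ΓW (.var a) T
  | pabs {ΓW a t T T'} :
      TyTm R Δ procs (ΓW.upd a T) t T' → ((Ty.arrow T T').order : WithTop ℕ) ≤ R →
      TyTm R Δ procs ΓW (.lam a t) (.arrow T T')
  | papp {ΓW t1 t2 T T'} :
      TyTm R Δ procs ΓW t1 (.arrow T T') → TyTm R Δ procs ΓW t2 T →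
      TyTm R Δ procs ΓW (.app t1 t2) T'
  | pcall {ΓW P cs ts p} :
      p ∈ procs → p.name = P →
      cs.length = p.oparams.length → ts.length = p.params.length →
      (∀ c ∈ cs, TyTm R Δ procs (ΓW.upd (.v0 c.1) .W) c.2 .W) →
      (∀ t ∈ ts, TyTm R Δ procs ΓW t .W) →
      TyTm R Δ procs ΓW (.call P cs ts) .W

/-- Simple typing judgments for programs. -/
inductive TyProg (R : WithTop ℕ) (Δ : OTE) (Ω : PEnv) : List Proc → TEnv → Prog → Ty → Prop
  | pterm {procs ΓW t T} : TyTm R Δ procs ΓW t T → TyProg R Δ Ω procs ΓW (.term t) T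
  | pdec {procs ΓW ps prg T} :
      (∀ p ∈ ps, TyStmt (Ω p).1 Δ p.body (Ω p).2) →
      TyProg R Δ Ω (procs ++ ps) ΓW prg T →
      TyProg R Δ Ω procs ΓW (.declare ps prg) T
  | pbox {procs ΓW a prg T T'} :
      TyProg R Δ Ω procs (ΓW.upd a T) prg T' →
      TyProg R Δ Ω procs ΓW (.box a prg) (.arrow T T')

/-! ## FP : polynomial time computable functions (via (oracle) Turing machines) -/

/-- Second-order polynomials with `k` function variables and `l` base variables. -/
inductive SOP (k l : ℕ) where
  | const : ℕ → SOP k l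
  | var : Fin l → SOP k l
  | app : Fin k → SOP k l → SOP k l
  | add : SOP k l → SOP k l → SOP k l
  | mul : SOP k l → SOP k l → SOP k l

def SOP.eval {k l : ℕ} : SOP k l → (Fin k → ℕ → ℕ) → (Fin l → ℕ) → ℕ
  | .const n, _, _ => n
  | .var j, _, xs => xs j
  | .app i p, fs, xs => fs i (p.eval fs xs)
  | .add p q, fs, xs => p.eval fs xs + q.eval fs xs
  | .mul p q, fs, xs => p.eval fs xs * q.eval fs xs

/-- The size `|f|` of an oracle `f` : `|f|(n) = max_{|y| ≤ n} |f(y)|`. -/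
noncomputable def oSize (f : Wd → Wd) (n : ℕ) : ℕ :=
  sSup { s | ∃ y : Wd, y.length ≤ n ∧ s = (f y).length }

inductive TDir where | left | right

/-- A Turing machine tape over the alphabet `Option Bool` (`none` = blank), with finitely
many non-blank cells. -/
structure MTape where
  left : List (Option Bool)
  head : Option Bool
  right : List (Option Bool)

def MTape.move : TDir → MTape → MTape
  | .left, ⟨[], h, r⟩ => ⟨[], none, h :: r⟩
  | .left, ⟨a :: l, h, r⟩ => ⟨l, a, h :: r⟩
  | .right, ⟨l, h, []⟩ => ⟨h :: l, none, []⟩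
  | .right, ⟨l, h, a :: r⟩ => ⟨h :: l, a, r⟩

def MTape.write (b : Option Bool) (t : MTape) : MTape := ⟨t.left, b, t.right⟩

/-- The word written on the tape from the head rightwards, up to the first blank. -/
def MTape.wordAt (t : MTape) : Wd :=
  ((t.head :: t.right).takeWhile Option.isSome).filterMap id

/-- Replace the tape content, from the head rightwards, by the word `w`. -/
def MTape.setWord (w : Wd) (t : MTape) : MTape :=
  ⟨t.left, w.head?, w.tail.map some⟩

def MTape.init (w : Wd) : MTape := ⟨[], w.head?, w.tail.map some⟩

inductive OTMAct (k n : ℕ) where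
  | halt
  | step (write : Option Bool) (mv : TDir) (next : Fin n)
  | query (i : Fin k) (next : Fin n)

/-- A deterministic oracle Turing machine with `k` oracles; a `query i` step replaces the
tape content at the head by the answer of the `i`-th oracle on it. -/
structure OTM (k : ℕ) where
  n : ℕ
  δ : Fin (n + 1) → Option Bool → OTMAct k (n + 1)

def OTM.step1 {k : ℕ} (M : OTM k) (fs : Fin k → Wd → Wd)
    (c : Fin (M.n + 1) × MTape) : Fin (M.n + 1) × MTape :=
  match M.δ c.1 c.2.head with
  | .halt => c
  | .step b d q' => (q', (c.2.write b).move d)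
  | .query i q' => (q', c.2.setWord (fs i c.2.wordAt))

def OTM.isHalt {k : ℕ} (M : OTM k) (c : Fin (M.n + 1) × MTape) : Prop :=
  M.δ c.1 c.2.head = .halt

/-- `M` on oracles `fs` and input `inp` halts within `T` steps with output `out`. -/
def OTM.Outputs {k : ℕ} (M : OTM k) (fs : Fin k → Wd → Wd) (inp out : Wd) (T : ℕ) : Prop :=
  ∃ m ≤ T, M.isHalt ((M.step1 fs)^[m] (0, MTape.init inp)) ∧
    ((M.step1 fs)^[m] (0, MTape.init inp)).2.wordAt = out

/-- The empty family of oracles. -/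
def noOracle : Fin 0 → Wd → Wd := fun i => i.elim0

/-- The empty family of oracle sizes. -/
def noOSize : Fin 0 → ℕ → ℕ := fun i => i.elim0

/-- `g` (of arity `n`) is polynomial-time computable. -/
def InFP (n : ℕ) (g : List Wd → Wd) : Prop :=
  ∃ (M : OTM 0) (P : SOP 0 n), ∀ ws : List Wd, ws.length = n →
    M.Outputs noOracle (encTuple ws) (g ws)
      (P.eval noOSize (fun j => (ws.getD j []).length))

/-- The class `FP` of first-order polynomial time computable functions, as a set of
functionals of simple type over `W`. -/
def FPset : Set Functional :=
  { G | ∃ n g, InFP n g ∧ G = ⟨ty1 n, curryList n g⟩ }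

/-! ## Safe operator typing environments and safe programs -/

/-- A safe operator typing environment. -/
def SafeOTE (Δ : OTE) : Prop :=
  ∀ o k ks k', (ks, k') ∈ Δ o k →
    (NeutralOp o ∨ PositiveOp o) ∧ InFP (opArity o) (opSem o) ∧
    ks.length = opArity o ∧
    (∀ ki ∈ ks, k' ≤ ki ∧ ki ≤ k) ∧
    (¬ NeutralOp o → k' < k)

/-- Programs typable (with a second-order type) under the given safe operator typing
environment, with rank bound `R`. -/
def SAFEdet (R : WithTop ℕ) (Δ : OTE) : Set Prog :=
  { prg | ∃ (ΓW : TEnv) (Ω : PEnv) (T : Ty), TyProg R Δ Ω [] ΓW prg T ∧ IsTy2 T }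

/-- `SAFE` : the set of safe programs. -/
def SAFE : Set Prog := { prg | ∃ Δ : OTE, SafeOTE Δ ∧ prg ∈ SAFEdet ⊤ Δ }

/-- `SAFE_r` : the set of safe rank-`r` programs. -/
def SAFEr (r : ℕ) : Set Prog := { prg | ∃ Δ : OTE, SafeOTE Δ ∧ prg ∈ SAFEdet (r : WithTop ℕ) Δ }

/-! ## Safe and terminating procedures -/

/-- The canonical procedure-call term `call P({z → Y₁@z}, …, {z → Y_k@z}, ȳ)` with the
boxed variables `Y_i = v1 i` and `y_j = v0 j`. -/
def ProcCallTm (p : Proc) : Tm :=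
  .call p.name
    ((List.range p.oparams.length).map fun i =>
      (p.params.length, Tm.app (.var (.v1 i)) (.var (.v0 p.params.length))))
    ((List.range p.params.length).map fun j => Tm.var (.v0 j))

def procInitStore (p : Proc) (fl : List (Wd → Wd)) (wl : List Wd) : Store :=
  initStore (List.range p.oparams.length) (List.range p.params.length) fl wl

/-- A terminating procedure. -/
def ProcTerminates (p : Proc) : Prop :=
  ∀ (fl : List (Wd → Wd)) (wl : List Wd),
    fl.length = p.oparams.length → wl.length = p.params.length →
    ∃ v, EvalTm [p] (procInitStore p fl wl) (ProcCallTm p) v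

/-- A safe procedure: its body is tier-typable under some safe operator typing
environment. -/
def ProcSafe (p : Proc) : Prop :=
  ∃ (Γ : VEnv) (Δ : OTE) (ks : ℕ × ℕ × ℕ), SafeOTE Δ ∧ TyStmt Γ Δ p.body ks

/-- The procedure `p` computes the total second-order functional `F`. -/
def ProcComputes (p : Proc) (k l : ℕ)
    (F : (Fin k → (Wd → Wd)) → (Fin l → Wd) → Wd) : Prop :=
  p.oparams.length = k ∧ p.params.length = l ∧
  ∀ (fs : Fin k → (Wd → Wd)) (ws : Fin l → Wd),
    EvalTm [p] (procInitStore p (List.ofFn fs) (List.ofFn ws)) (ProcCallTm p) (F fs ws)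

/-- `⟦ST⟧` : the functionals computed by safe and terminating procedures. -/
def STfuns : Set Functional :=
  { G | ∃ p k l F, ProcSafe p ∧ ProcComputes p k l F ∧ G = ⟨ty2 k l, curry2 k l F⟩ }

/-- The wrapper program `box[Ȳ, ȳ] in declare p in call P({z → Y₁@z}, …, ȳ)`. -/
def wrapperOf (p : Proc) : Prog :=
  mkBoxes ((List.range p.oparams.length).map .v1 ++ (List.range p.params.length).map .v0)
    (.declare [p] (.term (ProcCallTm p)))

/-! ## BFF -/

/-- `BFF` : the basic feasible functionals, i.e. the second-order functionals computable
by an oracle Turing machine in time bounded by a second-order polynomial in the sizes of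
the oracles and the lengths of the inputs. -/
def BFF : Set Functional :=
  { G | ∃ (k l : ℕ) (M : OTM k) (P : SOP k l)
          (F : (Fin k → (Wd → Wd)) → (Fin l → Wd) → Wd),
      (∀ fs xs, M.Outputs fs (encTuple (List.ofFn xs)) (F fs xs)
        (P.eval (fun i => oSize (fs i)) (fun j => (xs j).length))) ∧
      G = ⟨ty2 k l, curry2 k l F⟩ }

/-! ## Polynomial-time decision problems -/

/-- A polynomial-time decidable language of words. -/
def PTimeLang (L : Set Wd) : Prop :=
  ∃ (M : OTM 0) (P : SOP 0 1), ∀ w : Wd,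
    (w ∈ L → M.Outputs noOracle w [true] (P.eval noOSize (fun _ => w.length))) ∧
    (w ∉ L → M.Outputs noOracle w [false] (P.eval noOSize (fun _ => w.length)))

/-- A polynomial-time computable function on words. -/
def PTimeFun (r : Wd → Wd) : Prop :=
  ∃ (M : OTM 0) (P : SOP 0 1), ∀ w : Wd,
    M.Outputs noOracle w (r w) (P.eval noOSize (fun _ => w.length))

/-- A `P`-complete language: in `P`, and every language in `P` reduces to it via a
polynomial-time many-one reduction. -/
def PComplete (L : Set Wd) : Prop :=
  PTimeLang L ∧ ∀ L' : Set Wd, PTimeLang L' →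
    ∃ r : Wd → Wd, PTimeFun r ∧ ∀ w, w ∈ L' ↔ r w ∈ L

/-- The language of (encodings of) the programs in `S`. -/
def encLang (S : Set Prog) : Set Wd := { w | ∃ prg ∈ S, w = prg.enc }

/-- The set `S` of programs is decidable in time `T` (as a function of the program
size). -/
def DecidesInTime (S : Set Prog) (T : ℕ → ℕ) : Prop :=
  ∃ M : OTM 0, ∀ prg : Prog,
    (prg ∈ S → M.Outputs noOracle prg.enc [true] (T prg.size)) ∧
    (prg ∉ S → M.Outputs noOracle prg.enc [false] (T prg.size))
/-! ## Size-change graphs and the criterion `SCP_S` -/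

/-- A size-change graph over the type-0 variables: `G y z = some true` is a down-arrow
from `y` to `z`, `some false` a plain arrow, `none` no arrow. -/
def SCG : Type := ℕ → ℕ → Option Bool

instance : Inhabited SCG := ⟨fun _ _ => none⟩

/-- `op` is decreasing in its `i`-th argument (`strict = true` for strictly
decreasing): fixed choices for the concrete operator suite
(`pred` strictly decreasing in 0, `head` decreasing in 0, `lmin` decreasing in 1). -/
def opDec : ℕ → Option (ℕ × Bool)
  | 1 => some (0, true)
  | 4 => some (0, false)
  | 7 => some (1, false)
  | _ => none

/-- The size-change graph of an assignment `x := e` with (optional) in-arrow to `x`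
from `src.1`, a down-arrow when `src.2 = true`; all other variables keep identity
arrows, and `x` receives no other in-arrow. -/
def mkSCG (x : ℕ) (src : Option (ℕ × Bool)) : SCG := fun y z =>
  if z = x then
    match src with
    | some s => if y = s.1 then some s.2 else none
    | none => none
  else if y = z then some false
  else none

/-- The (source, strictness) of the arrow pointing into the assigned variable, as
determined by the right-hand side expression. -/
def exprSrc : Expr → Option (ℕ × Bool)
  | .var y => some (y, false)
  | .op o args =>
      match opDec o with
      | some (i, d) =>
          match args[i]? with
          | some (.var xi) => some (xi, d)
          | _ => none
      | none => none
  | .oracleCall _ _ _ => none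

/-- Finite iteration (Kleene star) of a set of finite sequences of size-change graphs. -/
inductive StarMem (X : Set (List SCG)) : List SCG → Prop
  | nil : StarMem X []
  | cons {a b : List SCG} : a ∈ X → StarMem X b → StarMem X (a ++ b)

/-- Append a finite sequence in front of an infinite one. -/
def appendInf (a : List SCG) (s : ℕ → SCG) : ℕ → SCG :=
  fun n => if n < a.length then a.getD n default else s (n - a.length)

def flatNthAux : ℕ → (ℕ → List SCG) → ℕ → ℕ → SCG
  | 0, g, i, n => (g i).getD n default
  | fuel + 1, g, i, n =>
      if n < (g i).length then (g i).getD n default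
      else flatNthAux fuel g (i + 1) (n - (g i).length)

/-- The infinite concatenation of infinitely many nonempty finite sequences. -/
def flatten (g : ℕ → List SCG) : ℕ → SCG := fun n => flatNthAux (n + 1) g 0 n

/-- `L(st)` : the language of finite (first component) and infinite (second component)
sequences of size-change graphs associated with a statement. -/
def Ls : Stmt → Set (List SCG) × Set (ℕ → SCG)
  | .skip => ({[]}, ∅)
  | .assign x e => ({[mkSCG x (exprSrc e)]}, ∅)
  | .seq s1 s2 =>
      ({ l | ∃ a ∈ (Ls s1).1, ∃ b ∈ (Ls s2).1, l = a ++ b },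
       (Ls s1).2 ∪ { f | ∃ a ∈ (Ls s1).1, ∃ g ∈ (Ls s2).2, f = appendInf a g })
  | .ite _ s1 s2 => ((Ls s1).1 ∪ (Ls s2).1, (Ls s1).2 ∪ (Ls s2).2)
  | .while _ s =>
      (StarMem (Ls s).1,
       { f | ∃ a, StarMem (Ls s).1 a ∧ ∃ g ∈ (Ls s).2, f = appendInf a g } ∪
       { f | ∃ g : ℕ → List SCG, (∀ n, g n ∈ (Ls s).1 ∧ g n ≠ []) ∧ f = flatten g })

/-- Fan-in freeness of a finite sequence of size-change graphs: each node has in-degree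
at most one. -/
def FanInFreeL (gs : List SCG) : Prop :=
  ∀ G ∈ gs, ∀ z y1 y2, (G y1 z).isSome → (G y2 z).isSome → y1 = y2

/-- Fan-in freeness of an infinite sequence of size-change graphs. -/
def FanInFreeI (f : ℕ → SCG) : Prop :=
  ∀ n z y1 y2, (f n y1 z).isSome → (f n y2 z).isSome → y1 = y2

/-- A down-thread from `x` to `x` in a finite sequence of size-change graphs: a path
spanning every graph of the sequence, starting and ending in `x`, and containing a
down-arrow. -/
def FinDT (x : ℕ) (gs : List SCG) : Prop :=
  ∃ p : ℕ → ℕ, p 0 = x ∧ p gs.length = x ∧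
    (∀ i < gs.length, ((gs.getD i default) (p i) (p (i + 1))).isSome) ∧
    (∃ i < gs.length, (gs.getD i default) (p i) (p (i + 1)) = some true)

/-- A down-thread from `x` in an infinite sequence of size-change graphs. -/
def InfDT (x : ℕ) (f : ℕ → SCG) : Prop :=
  ∃ p : ℕ → ℕ, p 0 = x ∧ (∀ i, (f i (p i) (p (i + 1))).isSome) ∧
    (∃ i, f i (p i) (p (i + 1)) = some true)

open scoped Classical in
/-- Restriction of a size-change graph to a set `V` of variables. -/
noncomputable def SCG.res (V : Set ℕ) (G : SCG) : SCG :=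
  fun y z => if y ∈ V ∧ z ∈ V then G y z else none

noncomputable def resList (V : Set ℕ) (gs : List SCG) : List SCG := gs.map (SCG.res V)

noncomputable def resInf (V : Set ℕ) (f : ℕ → SCG) : ℕ → SCG := fun n => (f n).res V

/-- Recognize a while guard of the shape `x ≠ ε`. -/
def isNeqEps : Expr → Option ℕ
  | .op 6 [.var x, .op 0 []] => some x
  | _ => none

/-- The set of variables occurring in while guards (of the shape `x ≠ ε`). -/
def guardVars : Stmt → Set ℕ
  | .skip => ∅
  | .assign _ _ => ∅
  | .seq s1 s2 => guardVars s1 ∪ guardVars s2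
  | .ite _ s1 s2 => guardVars s1 ∪ guardVars s2
  | .while e s =>
      (match isNeqEps e with | some x => {x} | none => ∅) ∪ guardVars s

/-- The simple graph property for the set `V` of variables: every while loop has a guard
of the shape `x ≠ ε` and every (finite or infinite) sequence of size-change graphs of its
body, restricted to `V`, is fan-in free and contains a down-thread from `x` to `x`. -/
def SGP (V : Set ℕ) : Stmt → Prop
  | .skip => True
  | .assign _ _ => True
  | .seq s1 s2 => SGP V s1 ∧ SGP V s2
  | .ite _ s1 s2 => SGP V s1 ∧ SGP V s2
  | .while e s =>
      (∃ x, isNeqEps e = some x ∧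
        (∀ gs ∈ (Ls s).1, FanInFreeL (resList V gs) ∧ FinDT x (resList V gs)) ∧
        (∀ f ∈ (Ls s).2, FanInFreeI (resInf V f) ∧ InfDT x (resInf V f))) ∧
      SGP V s

/-- A procedure satisfying the simple-graph size-change criterion. -/
def ProcSCP (p : Proc) : Prop := SGP (guardVars p.body) p.body

/-- `SCP_S` : programs all of whose procedures satisfy the simple-graph size-change
criterion. -/
def SCPs : Set Prog := { prg | ∀ p ∈ procsOf prg, ProcSCP p }

/-! ## A Turing machine for the unary operators -/

/-- The tape whose cells from the head rightwards are `cs` and whose cells to the left of the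
head, read leftwards, are `L`. -/
def MTape.ofCells (L cs : List (Option Bool)) : MTape := ⟨L, cs.headD none, cs.tail⟩

theorem MTape.init_eq_ofCells (w : Wd) : MTape.init w = MTape.ofCells [] (w.map some) := by
  cases w <;> rfl

theorem MTape.move_right_ofCells (L cs : List (Option Bool)) :
    (MTape.ofCells L cs).move .right = MTape.ofCells (cs.headD none :: L) cs.tail := by
  rcases cs with _ | ⟨a, _ | ⟨b, cs⟩⟩ <;> rfl

theorem MTape.move_left_ofCells (L cs : List (Option Bool)) :
    (MTape.ofCells L cs).move .left =
      MTape.ofCells L.tail (L.headD none :: cs.headD none :: cs.tail) := by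
  cases L <;> rfl

theorem MTape.write_ofCells (b : Option Bool) (L cs : List (Option Bool)) :
    (MTape.ofCells L cs).write b = MTape.ofCells L (b :: cs.tail) := rfl

theorem MTape.head_ofCells (L cs : List (Option Bool)) :
    (MTape.ofCells L cs).head = cs.headD none := rfl

theorem MTape.wordAt_ofCells_map_some (L : List (Option Bool)) (w : Wd) :
    (MTape.ofCells L (w.map some)).wordAt = w := by
  have h : ∀ v : Wd, List.filterMap id ((v.map some).takeWhile Option.isSome) = v := by
    intro v
    induction v with
    | nil => rfl
    | cons a v ih => simpa using ih
  cases w with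
  | nil => rfl
  | cons a w => exact h (a :: w)

/-- State of `unaryMachine` carrying the bit `b` to the right over the encoded input. -/
def carryInput (b : Bool) : Fin 17 := if b then 5 else 4

/-- State of `unaryMachine` carrying the bit `b` to the right over the decoded output. -/
def carryOutput (b : Bool) : Fin 17 := if b then 7 else 6

/-- Transition table of `unaryMachine`: state `1` decodes the input onto a separate block of
cells on the right, one bit per round trip; `11` drops the first bit before decoding; `13`
extracts the first bit; `10` halts. -/
def unaryTable (q : ℕ) (a : Option Bool) : OTMAct 0 17 :=
  match q, a with
  | 1, some true => .step none .right 2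
  | 1, _ => .step a .right 3
  | 2, some b => .step none .right (carryInput b)
  | 3, _ => .step a .right 9
  | 4, some _ => .step a .right 4
  | 4, none => .step a .right 6
  | 5, some _ => .step a .right 5
  | 5, none => .step a .right 7
  | 6, some _ => .step a .right 6
  | 6, none => .step (some false) .left 8
  | 7, some _ => .step a .right 7
  | 7, none => .step (some true) .left 8
  | 8, some _ => .step a .left 8
  | 8, none => .step a .left 15
  | 9, _ => .step a .right 10
  | 11, some true => .step none .right 12
  | 11, _ => .step a .right 3
  | 12, _ => .step none .right 1
  | 13, some true => .step a .right 14
  | 13, _ => .step none .left 10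
  | 14, _ => .step a .right 16
  | 16, _ => .step none .left 10
  | 15, some _ => .step a .left 15
  | 15, none => .step a .right 1
  | _, _ => .halt

/-- The machine running `unaryTable` from the state `start`. -/
def unaryMachine (start : Fin 17) : OTM 0 where
  n := 16
  δ q a := unaryTable (if q = 0 then start else q).val a

/-- The transition function of `unaryMachine start` on configurations. -/
def unaryStep (start : Fin 17) : Fin 17 × MTape → Fin 17 × MTape :=
  (unaryMachine start).step1 noOracle

/-- `unaryMachine start` goes from configuration `c` to configuration `d` in `m` steps. -/
def UnaryReach (start : Fin 17) (c d : Fin 17 × MTape) (m : ℕ) : Prop :=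
  (unaryStep start)^[m] c = d

theorem UnaryReach.trans {start : Fin 17} {c d e : Fin 17 × MTape} {m n : ℕ}
    (h₁ : UnaryReach start c d m) (h₂ : UnaryReach start d e n) :
    UnaryReach start c e (m + n) := by
  unfold UnaryReach at *
  rw [Nat.add_comm, Function.iterate_add_apply, h₁, h₂]

theorem UnaryReach.step {start q q' : Fin 17} {t : MTape} {b : Option Bool} {d : TDir}
    (hq : q ≠ 0) (h : unaryTable q.val t.head = .step b d q') :
    UnaryReach start (q, t) (q', (t.write b).move d) 1 := by
  simp [UnaryReach, unaryStep, OTM.step1, unaryMachine, hq, h]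

theorem UnaryReach.step_right {start q q' : Fin 17} {L cs : List (Option Bool)} {a b : Option Bool}
    (hq : q ≠ 0) (h : unaryTable q.val a = .step b .right q') :
    UnaryReach start (q, .ofCells L (a :: cs)) (q', .ofCells (b :: L) cs) 1 := by
  have := UnaryReach.step (start := start) (t := .ofCells L (a :: cs)) hq h
  rwa [MTape.write_ofCells, MTape.move_right_ofCells] at this

theorem UnaryReach.step_right_blank {start q q' : Fin 17} {L cs : List (Option Bool)}
    {b : Option Bool} (hq : q ≠ 0) (hcs : cs.headD none = none)
    (h : unaryTable q.val none = .step b .right q') :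
    UnaryReach start (q, .ofCells L cs) (q', .ofCells (b :: L) cs.tail) 1 := by
  have := UnaryReach.step (start := start) (t := .ofCells L cs) hq
    (by rw [MTape.head_ofCells, hcs]; exact h)
  rwa [MTape.write_ofCells, MTape.move_right_ofCells] at this

theorem UnaryReach.scan_right {start q : Fin 17} (hq : q ≠ 0)
    (h : ∀ c, unaryTable q.val (some c) = .step (some c) .right q) (v : Wd) :
    ∀ L cs : List (Option Bool),
      UnaryReach start (q, .ofCells L (v.map some ++ cs))
        (q, .ofCells (v.reverse.map some ++ L) cs) v.length := by
  induction v with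
  | nil => intro L cs; rfl
  | cons a v ih =>
    intro L cs
    have := (UnaryReach.step_right (start := start) (L := L) (cs := v.map some ++ cs) hq (h a)).trans
      (ih (some a :: L) cs)
    simpa [Nat.add_comm] using this

theorem UnaryReach.scan_left {start q : Fin 17} (hq : q ≠ 0)
    (h : ∀ c, unaryTable q.val (some c) = .step (some c) .left q) (v : Wd) :
    ∀ (L : List (Option Bool)) (a : Option Bool) (cs : List (Option Bool)),
      UnaryReach start (q, (MTape.ofCells (v.map some ++ L) (a :: cs)).move .left)
        (q, .ofCells L.tail (L.headD none :: (v.reverse.map some ++ a :: cs))) v.length := by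
  induction v with
  | nil =>
    intro L a cs
    rw [MTape.move_left_ofCells]
    rfl
  | cons b v ih =>
    intro L a cs
    have h₁ := UnaryReach.step (start := start)
      (t := (MTape.ofCells ((b :: v).map some ++ L) (a :: cs)).move .left) hq (h b)
    have h₂ : (((MTape.ofCells ((b :: v).map some ++ L) (a :: cs)).move .left).write (some b)).move
        .left = (MTape.ofCells (v.map some ++ L) (some b :: a :: cs)).move .left := by
      simp [MTape.move_left_ofCells, MTape.write_ofCells]
    rw [h₂] at h₁
    have := h₁.trans (ih L (some b) (a :: cs))
    simpa [Nat.add_comm] using this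

/-- `tail` is the part of the tape behind the encoded input when `out` has been decoded. -/
def OutputBlock (out : Wd) (tail : List (Option Bool)) : Prop :=
  tail.headD none = none ∧ tail.tail = out.map some

theorem UnaryReach.carry {start : Fin 17} (b : Bool) (L tail : List (Option Bool)) (run out : Wd)
    (hL : L.headD none = none) (ht : OutputBlock out tail) :
    ∃ L' : List (Option Bool), L'.headD none = none ∧
      UnaryReach start (carryInput b, .ofCells L (run.map some ++ tail))
        (1, .ofCells L' (run.map some ++ none :: (out ++ [b]).map some))
        (2 * run.length + 2 * out.length + 4) := by
  refine ⟨none :: L.tail, rfl, ?_⟩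
  have h₁ := UnaryReach.scan_right (start := start) (q := carryInput b) (by cases b <;> decide)
    (by intro c; cases b <;> rfl) run L tail
  have h₂ := UnaryReach.step_right_blank (start := start) (q := carryInput b)
    (q' := carryOutput b) (b := none) (L := run.reverse.map some ++ L) (cs := tail)
    (by cases b <;> decide) ht.1 (by cases b <;> rfl)
  have h₃ := UnaryReach.scan_right (start := start) (q := carryOutput b) (by cases b <;> decide)
    (by intro c; cases b <;> rfl) out (none :: (run.reverse.map some ++ L)) []
  have h₄ := UnaryReach.step (start := start) (q := carryOutput b) (q' := 8) (b := some b)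
    (d := .left) (t := .ofCells (out.reverse.map some ++ none :: (run.reverse.map some ++ L)) [])
    (by cases b <;> decide) (by cases b <;> rfl)
  have h₅ := UnaryReach.scan_left (start := start) (q := 8) (by decide) (by intro c; rfl)
    out.reverse (none :: (run.reverse.map some ++ L)) (some b) []
  have h₆ := UnaryReach.step (start := start) (q := 8) (q' := 15) (b := none)
    (d := .left) (t := .ofCells (run.reverse.map some ++ L) (none :: (out.map some ++ [some b])))
    (by decide) rfl
  have h₇ := UnaryReach.scan_left (start := start) (q := 15) (by decide) (by intro c; rfl)
    run.reverse L none (out.map some ++ [some b])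
  have h₈ := UnaryReach.step_right_blank (start := start) (q := 15) (q' := 1) (b := none)
    (L := L.tail) (cs := L.headD none :: (run.map some ++ none :: (out.map some ++ [some b])))
    (by decide) hL rfl
  rw [ht.2] at h₂
  rw [List.append_nil] at h₃
  simp only [MTape.write_ofCells, List.tail_cons, List.tail_nil, List.reverse_reverse,
    List.headD_cons, List.length_reverse] at h₄ h₅ h₆ h₇ h₈
  have := ((((((h₁.trans h₂).trans h₃).trans h₄).trans h₅).trans h₆).trans h₇).trans h₈
  have e : run.length + 1 + out.length + 1 + out.length + 1 + run.length + 1 =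
      2 * run.length + 2 * out.length + 4 := by omega
  rw [e] at this
  simpa using this

/-- The encoding of a word without its end marker. -/
def bitPairs (w : Wd) : Wd := w.flatMap fun b => [true, b]

theorem bitPairs_cons (b : Bool) (w : Wd) : bitPairs (b :: w) = true :: b :: bitPairs w := rfl

theorem bitPairs_length (w : Wd) : (bitPairs w).length = 2 * w.length := by
  induction w with
  | nil => rfl
  | cons b w ih => rw [bitPairs_cons]; simp only [List.length_cons, ih]; omega

theorem encTuple_singleton (w : Wd) : encTuple [w] = bitPairs w ++ [false, false] := by
  simp [encTuple, bitPairs]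

theorem UnaryReach.finish {start q : Fin 17} (hq : q = 1 ∨ q = 11) (L tail : List (Option Bool))
    (out : Wd) (ht : OutputBlock out tail) :
    ∃ L', UnaryReach start (q, .ofCells L (some false :: some false :: tail))
      (10, .ofCells L' (out.map some)) 3 := by
  have h₁ := UnaryReach.step_right (start := start) (q := q) (q' := 3) (L := L)
    (a := some false) (b := some false) (cs := some false :: tail)
    (by rcases hq with rfl | rfl <;> decide) (by rcases hq with rfl | rfl <;> rfl)
  have h₂ := UnaryReach.step_right (start := start) (q := 3) (q' := 9) (L := some false :: L)
    (a := some false) (b := some false) (cs := tail) (by decide) rfl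
  have h₃ := UnaryReach.step_right_blank (start := start) (q := 9) (q' := 10)
    (L := some false :: some false :: L) (cs := tail) (b := none) (by decide) ht.1 rfl
  rw [ht.2] at h₃
  exact ⟨_, (h₁.trans h₂).trans h₃⟩

theorem UnaryReach.decode {start : Fin 17} (w : Wd) :
    ∀ (L tail : List (Option Bool)) (out : Wd), L.headD none = none → OutputBlock out tail →
      ∃ m ≤ w.length * (4 * (w.length + out.length) + 10) + 3, ∃ L',
        UnaryReach start (1, .ofCells L ((bitPairs w ++ [false, false]).map some ++ tail))
          (10, .ofCells L' ((out ++ w).map some)) m := by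
  induction w with
  | nil =>
    intro L tail out _ ht
    obtain ⟨L', h⟩ := UnaryReach.finish (start := start) (Or.inl rfl) L tail out ht
    exact ⟨3, by simp, L', by simpa [bitPairs] using h⟩
  | cons b w ih =>
    intro L tail out _ ht
    have h₁ := UnaryReach.step_right (start := start) (q := 1) (q' := 2) (L := L)
      (a := some true) (b := none)
      (cs := some b :: ((bitPairs w ++ [false, false]).map some ++ tail)) (by decide) rfl
    have h₂ := UnaryReach.step_right (start := start) (q := 2) (q' := carryInput b)
      (L := none :: L) (a := some b) (b := none)
      (cs := (bitPairs w ++ [false, false]).map some ++ tail) (by decide) rfl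
    obtain ⟨L₁, hL₁, h₃⟩ := UnaryReach.carry (start := start) b (none :: none :: L) tail
      (bitPairs w ++ [false, false]) out rfl ht
    obtain ⟨m, hm, L', h₄⟩ := ih L₁ (none :: (out ++ [b]).map some) (out ++ [b]) hL₁ ⟨rfl, rfl⟩
    refine ⟨1 + 1 + (2 * (bitPairs w ++ [false, false]).length + 2 * out.length + 4) + m,
      ?_, L', ?_⟩
    · simp only [List.length_append, bitPairs_length, List.length_cons, List.length_nil] at hm ⊢
      nlinarith
    · have := ((h₁.trans h₂).trans h₃).trans h₄
      simpa [bitPairs_cons] using this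

theorem unaryStep_apply (start q : Fin 17) (t : MTape) :
    unaryStep start (q, t) =
      match unaryTable (if q = 0 then start else q).val t.head with
      | .halt => (q, t)
      | .step b d q' => (q', (t.write b).move d)
      | .query i q' => (q', t.setWord (noOracle i t.wordAt)) := by
  have e : (unaryMachine start).δ q t.head =
      unaryTable (if q = 0 then start else q).val t.head := rfl
  unfold unaryStep OTM.step1
  simp only [e]
  split <;> simp_all <;> rfl

theorem unaryMachine_outputs {start : Fin 17} (hs : ∀ a, unaryTable start.val a ≠ .halt)
    (hs₀ : start ≠ 0) {w out : Wd} {L cs : List (Option Bool)} {m T : ℕ} (hm : m ≤ T)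
    (h : UnaryReach start (start, MTape.ofCells [] (w.map some)) (10, .ofCells L cs) m)
    (hout : (MTape.ofCells L cs).wordAt = out) :
    (unaryMachine start).Outputs noOracle w out T := by
  have hfirst : ∀ t : MTape, unaryStep start (0, t) = unaryStep start (start, t) := by
    intro t
    have h₁ := hs t.head
    rw [unaryStep_apply, unaryStep_apply, if_pos rfl, ite_self]
    cases hq : unaryTable start.val t.head with
    | halt => exact absurd hq h₁
    | step b d q => rfl
    | query i q => rfl
  have h₀ : (unaryStep start)^[m] (0, MTape.init w) = (10, .ofCells L cs) := by
    rw [MTape.init_eq_ofCells]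
    cases m with
    | zero =>
      have : start = 10 := congrArg Prod.fst h
      subst this
      exact absurd rfl (hs none)
    | succ m =>
      unfold UnaryReach at h
      rw [Function.iterate_succ_apply] at h ⊢
      rw [hfirst, h]
  refine ⟨m, hm, ?_, ?_⟩
  · change OTM.isHalt (unaryMachine start) ((unaryStep start)^[m] (0, MTape.init w))
    rw [h₀]
    rfl
  · change ((unaryStep start)^[m] (0, MTape.init w)).2.wordAt = out
    rw [h₀]
    exact hout

theorem inFP_one_of_outputs {g : List Wd → Wd} {M : OTM 0}
    (h : ∀ w : Wd, M.Outputs noOracle (encTuple [w]) (g [w]) (4 * w.length ^ 2 + 20 * w.length + 20)) :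
    InFP 1 g := by
  refine ⟨M, .add (.mul (.add (.mul (.const 4) (.var 0)) (.const 20)) (.var 0)) (.const 20), ?_⟩
  intro ws hws
  obtain ⟨w, rfl⟩ := List.length_eq_one_iff.mp hws
  obtain ⟨m, hm, h₁⟩ := h w
  refine ⟨m, hm.trans (le_of_eq ?_), h₁⟩
  simp only [SOP.eval, List.getD_cons_zero, Fin.val_zero]
  ring

theorem inFP_eps : InFP (opArity 0) (opSem 0) := by
  refine ⟨⟨0, fun _ _ => .halt⟩, .const 0, ?_⟩
  intro ws hws
  obtain rfl := List.length_eq_zero_iff.mp hws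
  exact ⟨0, le_rfl, rfl, rfl⟩

theorem inFP_pred : InFP (opArity 1) (opSem 1) := by
  refine inFP_one_of_outputs (M := unaryMachine 11) ?_
  intro w
  rw [encTuple_singleton]
  cases w with
  | nil =>
    obtain ⟨L, h⟩ := UnaryReach.finish (start := 11) (Or.inr rfl) [] [] [] ⟨rfl, rfl⟩
    exact unaryMachine_outputs (by rintro (_ | _ | _) <;> simp [unaryTable]) (by decide) (m := 3)
      (by simp) (by simpa [bitPairs] using h) (MTape.wordAt_ofCells_map_some L [])
  | cons b w =>
    have h₁ := UnaryReach.step_right (start := 11) (q := 11) (q' := 12) (L := [])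
      (a := some true) (b := none)
      (cs := some b :: ((bitPairs w ++ [false, false]).map some ++ [])) (by decide) rfl
    have h₂ := UnaryReach.step_right (start := 11) (q := 12) (q' := 1)
      (L := [none]) (a := some b) (b := none)
      (cs := (bitPairs w ++ [false, false]).map some ++ []) (by decide) rfl
    obtain ⟨m, hm, L, h₃⟩ := UnaryReach.decode (start := 11) w [none, none] [] [] rfl ⟨rfl, rfl⟩
    refine unaryMachine_outputs (m := 1 + 1 + m) (by rintro (_ | _ | _) <;> simp [unaryTable])
      (by decide) ?_ (by simpa [bitPairs_cons] using (h₁.trans h₂).trans h₃)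
      (MTape.wordAt_ofCells_map_some L w)
    simp only [List.length_cons, List.length_nil] at hm ⊢
    nlinarith

theorem unaryMachine_outputs_cons (b : Bool) (w : Wd) :
    (unaryMachine (carryInput b)).Outputs noOracle (encTuple [w]) (b :: w)
      (4 * w.length ^ 2 + 20 * w.length + 20) := by
  rw [encTuple_singleton]
  obtain ⟨L₁, hL₁, h₁⟩ := UnaryReach.carry (start := carryInput b) b [] []
    (bitPairs w ++ [false, false]) [] rfl ⟨rfl, rfl⟩
  obtain ⟨m, hm, L, h₂⟩ := UnaryReach.decode (start := carryInput b) w L₁ (none :: [b].map some) [b]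
    hL₁ ⟨rfl, rfl⟩
  refine unaryMachine_outputs
    (by rintro (_ | _ | _) <;> cases b <;> simp [unaryTable, carryInput])
    (by cases b <;> decide) ?_ (by simpa using h₁.trans h₂)
    (MTape.wordAt_ofCells_map_some L (b :: w))
  simp only [List.length_cons, List.length_nil, bitPairs_length] at hm ⊢
  nlinarith

theorem inFP_suc0 : InFP (opArity 2) (opSem 2) :=
  inFP_one_of_outputs (unaryMachine_outputs_cons false)

theorem inFP_suc1 : InFP (opArity 3) (opSem 3) :=
  inFP_one_of_outputs (unaryMachine_outputs_cons true)

theorem inFP_head : InFP (opArity 4) (opSem 4) := by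
  refine inFP_one_of_outputs (M := unaryMachine 13) ?_
  intro w
  rw [encTuple_singleton]
  have hs : ∀ a, unaryTable (13 : Fin 17).val a ≠ .halt := by
    rintro (_ | _ | _) <;> simp [unaryTable]
  cases w with
  | nil =>
    exact unaryMachine_outputs (L := []) (cs := [none, none, some false]) (m := 1) hs (by decide)
      (by simp) rfl rfl
  | cons b w =>
    obtain ⟨a, v, hv⟩ : ∃ a v, bitPairs w ++ [false, false] = a :: v := by
      cases w with
      | nil => exact ⟨_, _, rfl⟩
      | cons c w => exact ⟨_, _, rfl⟩
    have h₁ := UnaryReach.step_right (start := 13) (q := 13) (q' := 14) (L := [])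
      (a := some true) (b := some true) (cs := some b :: some a :: v.map some) (by decide) rfl
    have h₂ := UnaryReach.step_right (start := 13) (q := 14) (q' := 16) (L := [some true])
      (a := some b) (b := some b) (cs := some a :: v.map some) (by decide) rfl
    have h₃ := UnaryReach.step (start := 13) (q := 16) (q' := 10) (b := none) (d := .left)
      (t := .ofCells [some b, some true] (some a :: v.map some)) (by decide) rfl
    rw [MTape.write_ofCells, MTape.move_left_ofCells] at h₃
    refine unaryMachine_outputs (m := 3) hs (by decide) (by omega) ?_ ?_
      (L := [some true]) (cs := some b :: none :: v.map some)
    · rw [bitPairs_cons, List.cons_append, List.cons_append, hv]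
      exact (h₁.trans h₂).trans h₃
    · rfl

/-! ## Running statements under the identity closure -/

/-- The continuation sending the type-1 variable `0` to the closure of the identity. -/
def idCnt : Cnt := contOf [0] [(0, Tm.var (.v0 0))]

/-- Evaluation of expressions under `idCnt`. -/
def Evals (s : Store) (e : Expr) (w : Wd) : Prop := ∀ σ, EvalExpr σ s idCnt e w

/-- Execution of statements under `idCnt`. -/
def Runs (s : Store) (st : Stmt) (s' : Store) : Prop := ∀ σ, EvalStmt σ s idCnt st s'

theorem Evals.var {s : Store} {x : ℕ} {v : Wd} (h : s.w x = some v) : Evals s (.var x) v :=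
  fun _ => .var h

namespace Expr

/-- The expression `ε`. -/
def eps : Expr := .op 0 []

/-- The expression `pred e`. -/
def pr (e : Expr) : Expr := .op 1 [e]

/-- The expression `suc₀ e` or `suc₁ e`. -/
def suc (b : Bool) (e : Expr) : Expr := .op (if b then 3 else 2) [e]

/-- The expression `head e`. -/
def hd (e : Expr) : Expr := .op 4 [e]

/-- The identity oracle called on `e`, truncated to the length of variable `1`. -/
def top (e : Expr) : Expr := .oracleCall 0 e (.var 1)

end Expr

theorem Evals.eps (s : Store) : Evals s .eps [] := fun _ =>
  EvalExpr.op (o := 0) (args := []) [] rfl rfl (by simp)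

theorem Evals.op_one {s : Store} {e : Expr} {w : Wd} {o : ℕ} (ho : opArity o = 1)
    (h : Evals s e w) : Evals s (.op o [e]) (opSem o [w]) := fun σ => by
  refine EvalExpr.op (o := o) (args := [e]) [w] ho.symm rfl ?_
  rintro (_ | i) e' w' he hw
  · simp only [List.getElem?_cons_zero, Option.some.injEq] at he hw
    subst he hw
    exact h σ
  · simp at he

theorem Evals.pr {s : Store} {e : Expr} {w : Wd} (h : Evals s e w) : Evals s e.pr w.tail :=
  Evals.op_one (o := 1) rfl h

theorem Evals.suc {s : Store} {e : Expr} {w : Wd} (b : Bool) (h : Evals s e w) :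
    Evals s (e.suc b) (b :: w) := by
  cases b
  · exact Evals.op_one (o := 2) rfl h
  · exact Evals.op_one (o := 3) rfl h

theorem Evals.hd {s : Store} {e : Expr} {w : Wd} (h : Evals s e w) : Evals s e.hd (w.take 1) :=
  Evals.op_one (o := 4) rfl h

theorem Evals.oracle {s : Store} {e₁ e₂ : Expr} {v u : Wd} (h₁ : Evals s e₁ v)
    (h₂ : Evals s e₂ u) : Evals s (.oracleCall 0 e₁ e₂) (truncW v u) := fun σ =>
  EvalExpr.orc (x := 0) (t := .var (.v0 0)) (h₁ σ) (h₂ σ) rfl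
    (EvalTm.tvar (.val (.var0 0)) (by simp [Store.updW0]))

theorem Evals.top {s : Store} {e : Expr} {v : Wd} (h : Evals s e v)
    (hu : s.w 1 = some [false, false]) : Evals s e.top (truncW v [false, false]) :=
  h.oracle (.var hu)

theorem Runs.skip (s : Store) : Runs s .skip s := fun _ => .skip

theorem Runs.assign {s : Store} {x : ℕ} {e : Expr} {w : Wd} (h : Evals s e w) :
    Runs s (.assign x e) (s.updW0 x w) := fun σ => .asg (h σ)

theorem Runs.seq {s s' s'' : Store} {st st' : Stmt} (h : Runs s st s') (h' : Runs s' st' s'') :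
    Runs s (.seq st st') s'' := fun σ => .seq (h σ) (h' σ)

theorem Runs.ite {s s' : Store} {e : Expr} {st₁ st₀ : Stmt} (b : Bool) (he : Evals s e [b])
    (h : Runs s (if b then st₁ else st₀) s') : Runs s (.ite e st₁ st₀) s' := by
  cases b
  · exact fun σ => .condF (he σ) (h σ)
  · exact fun σ => .condT (he σ) (h σ)

theorem Runs.while_false {s : Store} {e : Expr} {st : Stmt} (he : Evals s e [false]) :
    Runs s (.while e st) s := fun σ => .whF (he σ)

theorem Runs.while_true {s s' s'' : Store} {e : Expr} {st : Stmt} (he : Evals s e [true])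
    (h : Runs s st s') (h' : Runs s' (.while e st) s'') : Runs s (.while e st) s'' :=
  fun σ => .whT (he σ) (.seq (h σ) (h' σ))

theorem Store.updW0_w (s : Store) (x : ℕ) (v : Wd) (y : ℕ) :
    (s.updW0 x v).w y = if y = x then some v else s.w y := rfl

/-! ## Polynomially bounded loops

Variable `0` holds the input `x`, `1` holds `00`, `2` holds `0ⁿ1` where `n = |x|`, `3` holds `1`
and `4` holds `0`; the variables from `13` on are loop counters. -/

/-- The values of the variables that are constant during the main computation. -/
structure BaseStore (x : Wd) (s : Store) : Prop where
  input : s.w 0 = some x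
  width : s.w 1 = some [false, false]
  counter : s.w 2 = some (List.replicate x.length false ++ [true])
  tt : s.w 3 = some [true]
  ff : s.w 4 = some [false]

theorem BaseStore.congr {x : Wd} {s s' : Store} (h : BaseStore x s)
    (hs : ∀ v < 5, s'.w v = s.w v) : BaseStore x s' :=
  ⟨(hs 0 (by omega)).trans h.input, (hs 1 (by omega)).trans h.width,
    (hs 2 (by omega)).trans h.counter, (hs 3 (by omega)).trans h.tt,
    (hs 4 (by omega)).trans h.ff⟩

/-- A description of stores by abstract states which depends on the first `13` variables only. -/
structure StoreRep (x : Wd) {α : Type*} (Rep : α → Store → Prop) : Prop where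
  base : ∀ a s, Rep a s → BaseStore x s
  congr : ∀ a s s', Rep a s → (∀ v < 13, s'.w v = s.w v) → Rep a s'

/-- `st` implements `f` on abstract states and does not modify the variables from `b` on. -/
def Implements {α : Type*} (Rep : α → Store → Prop) (b : ℕ) (st : Stmt) (f : α → α) : Prop :=
  ∀ a s, Rep a s → ∃ s', Runs s st s' ∧ Rep (f a) s' ∧ ∀ v ≥ b, s'.w v = s.w v

/-- Set the guard `b + 1` according to whether the counter `b` is exhausted. -/
def loopGuard (b : ℕ) : Stmt :=
  .ite (Expr.hd (.var b)) (.assign (b + 1) (.var 4)) (.assign (b + 1) (.var 3))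

/-- Execute `body` once for each letter of the input. -/
def inputLoop (b : ℕ) (body : Stmt) : Stmt :=
  .seq (.assign b (.var 2)) (.seq (loopGuard b)
    (.while (.var (b + 1)) (.seq (.assign b (Expr.pr (.var b))) (.seq body (loopGuard b)))))

/-- Number of counters used by `polyLoop`. -/
def SOP.counters : SOP 0 1 → ℕ
  | .const _ => 0
  | .var _ => 2
  | .app i _ => i.elim0
  | .add p q => p.counters + q.counters
  | .mul p q => p.counters + q.counters

/-- Execute `body` a number of times given by a polynomial in the length of the input, using
counters from `b` on. -/
def polyLoop : SOP 0 1 → ℕ → Stmt → Stmt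
  | .const k, _, body => (Stmt.seq body)^[k] .skip
  | .var _, b, body => inputLoop b body
  | .app i _, _, _ => i.elim0
  | .add p q, b, body => .seq (polyLoop p b body) (polyLoop q b body)
  | .mul p q, b, body => polyLoop p (b + q.counters) (polyLoop q b body)

section Loops

variable {x : Wd} {α : Type*} {Rep : α → Store → Prop}

theorem StoreRep.updW0 (hR : StoreRep x Rep) {a : α} {s : Store} (h : Rep a s) {b : ℕ}
    (hb : 13 ≤ b) (v : Wd) : Rep a (s.updW0 b v) :=
  hR.congr a s _ h fun y hy => by rw [Store.updW0_w, if_neg (by omega)]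

theorem StoreRep.loopGuard (hR : StoreRep x Rep) {a : α} {s : Store} (h : Rep a s) {b k : ℕ}
    (hb : s.w b = some (List.replicate k false ++ [true])) :
    Runs s (loopGuard b) (s.updW0 (b + 1) [decide (0 < k)]) := by
  have hd := (Evals.var hb).hd
  cases k with
  | zero => exact Runs.ite true hd (Runs.assign (.var (hR.base a s h).ff))
  | succ k => exact Runs.ite false hd (Runs.assign (.var (hR.base a s h).tt))

theorem Implements.inputLoop (hR : StoreRep x Rep) {b : ℕ} (hb : 13 ≤ b) {body : Stmt} {f : α → α}
    (h : Implements Rep b body f) : Implements Rep (b + 2) (inputLoop b body) f^[x.length] := by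
  have key : ∀ k a s, Rep a s → s.w b = some (List.replicate k false ++ [true]) →
      s.w (b + 1) = some [decide (0 < k)] →
      ∃ s', Runs s (.while (.var (b + 1)) (.seq (.assign b (Expr.pr (.var b)))
        (.seq body (_root_.loopGuard b)))) s' ∧
        Rep (f^[k] a) s' ∧ ∀ v ≥ b + 2, s'.w v = s.w v := by
    intro k
    induction k with
    | zero => exact fun a s hs _ h₁ => ⟨s, Runs.while_false (.var h₁), hs, fun _ _ => rfl⟩
    | succ k ih =>
      intro a s hs h₀ h₁
      obtain ⟨s₁, r₁, hs₁, e₁⟩ := h a _ (hR.updW0 hs hb (List.replicate k false ++ [true]))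
      have hb₁ : s₁.w b = some (List.replicate k false ++ [true]) := by
        rw [e₁ b le_rfl, Store.updW0_w, if_pos rfl]
      obtain ⟨s₂, r₂, hs₂, e₂⟩ := ih (f a) _
        (hR.updW0 hs₁ (b := b + 1) (by omega) [decide (0 < k)])
        (by rw [Store.updW0_w, if_neg (by omega), hb₁]) (by rw [Store.updW0_w, if_pos rfl])
      refine ⟨s₂, Runs.while_true (.var (by simpa using h₁))
        (Runs.seq (Runs.assign (Evals.var h₀).pr) (Runs.seq r₁ (hR.loopGuard hs₁ hb₁))) r₂,
        hs₂, fun v hv => ?_⟩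
      rw [e₂ v hv, Store.updW0_w, if_neg (by omega), e₁ v (by omega), Store.updW0_w,
        if_neg (by omega)]
  intro a s hs
  have hs₁ := hR.updW0 hs hb (List.replicate x.length false ++ [true])
  obtain ⟨s', r, hs', e⟩ := key x.length a _
    (hR.updW0 hs₁ (b := b + 1) (by omega) [decide (0 < x.length)])
    (by rw [Store.updW0_w, if_neg (by omega), Store.updW0_w, if_pos rfl])
    (by rw [Store.updW0_w, if_pos rfl])
  refine ⟨s', Runs.seq (Runs.assign (.var (hR.base a s hs).counter)) (Runs.seq
    (hR.loopGuard hs₁ (by rw [Store.updW0_w, if_pos rfl])) r), hs', fun v hv => ?_⟩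
  rw [e v hv, Store.updW0_w, if_neg (by omega), Store.updW0_w, if_neg (by omega)]

theorem Implements.polyLoop (hR : StoreRep x Rep) (Q : SOP 0 1) :
    ∀ {b : ℕ}, 13 ≤ b → ∀ {body : Stmt} {f : α → α}, Implements Rep b body f →
      Implements Rep (b + Q.counters) (polyLoop Q b body)
        f^[Q.eval noOSize fun _ => x.length] := by
  induction Q with
  | const k =>
    intro b hb body f h
    change Implements Rep b ((Stmt.seq body)^[k] .skip) f^[k]
    induction k with
    | zero => exact fun a s hs => ⟨s, Runs.skip s, hs, fun _ _ => rfl⟩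
    | succ k ih =>
      intro a s hs
      obtain ⟨s₁, r₁, hs₁, e₁⟩ := h a s hs
      obtain ⟨s₂, r₂, hs₂, e₂⟩ := ih (f a) s₁ hs₁
      refine ⟨s₂, ?_, hs₂, fun v hv => (e₂ v hv).trans (e₁ v hv)⟩
      rw [Function.iterate_succ_apply']
      exact r₁.seq r₂
  | var j => exact fun hb _ _ h => h.inputLoop hR hb
  | app i p => exact i.elim0
  | add p q ihp ihq =>
    intro b hb body f h a s hs
    obtain ⟨s₁, r₁, hs₁, e₁⟩ := ihp hb h a s hs
    obtain ⟨s₂, r₂, hs₂, e₂⟩ := ihq hb h _ s₁ hs₁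
    refine ⟨s₂, r₁.seq r₂, ?_, fun v hv => ?_⟩
    · rw [SOP.eval, Nat.add_comm, Function.iterate_add_apply]
      exact hs₂
    · simp only [SOP.counters] at hv
      rw [e₂ v (by omega), e₁ v (by omega)]
  | mul p q ihp ihq =>
    intro b hb body f h
    have := ihp (b := b + q.counters) (by omega) (ihq hb h)
    rw [← Function.iterate_mul] at this
    rw [SOP.eval, Nat.mul_comm, SOP.counters, Nat.add_comm p.counters, ← Nat.add_assoc]
    exact this

end Loops

/-! ## Tape cells as words -/

/-- The code of a tape cell. -/
def cellCode : Option Bool → Wd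
  | none => [true, false]
  | some b => [false, b]

/-- The code of a sequence of tape cells. -/
def cellsCode (cs : List (Option Bool)) : Wd := cs.flatMap cellCode

theorem truncW_cellsCode (cs : List (Option Bool)) :
    ∃ t, truncW (cellsCode cs) [false, false] = cellCode (cs.headD none) ++ t := by
  rcases cs with _ | ⟨_ | b, cs⟩
  · exact ⟨[false], rfl⟩
  · exact ⟨[true], rfl⟩
  · exact ⟨[true], rfl⟩

theorem tail_tail_cellsCode (cs : List (Option Bool)) :
    (cellsCode cs).tail.tail = cellsCode cs.tail := by
  rcases cs with _ | ⟨_ | b, cs⟩ <;> rfl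

namespace Expr

/-- Push the cell `c` on the cells coded by `e`. -/
def push : Option Bool → Expr → Expr
  | none, e => suc true (suc false e)
  | some b, e => suc false (suc b e)

/-- Drop the first cell of the cells coded by `e`. -/
def pop (e : Expr) : Expr := e.pr.pr

/-- The constant expression `1^q 0`. -/
def unary (q : ℕ) : Expr := (suc true)^[q] (suc false eps)

end Expr

theorem Evals.push {s : Store} {e : Expr} {cs : List (Option Bool)} (c : Option Bool)
    (h : Evals s e (cellsCode cs)) : Evals s (e.push c) (cellsCode (c :: cs)) := by
  cases c with
  | none => exact (h.suc false).suc true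
  | some b => exact (h.suc b).suc false

theorem Evals.pop {s : Store} {e : Expr} {cs : List (Option Bool)}
    (h : Evals s e (cellsCode cs)) : Evals s e.pop (cellsCode cs.tail) := by
  rw [← tail_tail_cellsCode]
  exact h.pr.pr

theorem Evals.unary (s : Store) (q : ℕ) :
    Evals s (.unary q) (List.replicate q true ++ [false]) := by
  induction q with
  | zero => exact (Evals.eps s).suc false
  | succ q ih =>
    rw [Expr.unary, Function.iterate_succ_apply']
    exact ih.suc true

/-- Case distinction on the cell held by variable `9`. -/
def cellCase (st : Option Bool → Stmt) : Stmt :=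
  .ite (Expr.hd (.var 9)) (st none)
    (.ite (Expr.hd (Expr.pr (.var 9))) (st (some true)) (st (some false)))

theorem Runs.cellCase {s s' : Store} {st : Option Bool → Stmt} {c : Option Bool} {t : Wd}
    (h : s.w 9 = some (cellCode c ++ t)) (hr : Runs s (st c) s') : Runs s (cellCase st) s' := by
  have h₁ := (Evals.var h).hd
  have h₂ := (Evals.var h).pr.hd
  rcases c with _ | _ | _
  · exact Runs.ite true h₁ hr
  · exact Runs.ite false h₁ (Runs.ite false h₂ hr)
  · exact Runs.ite false h₁ (Runs.ite true h₂ hr)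

/-- Select a statement of a list by the unary number `e`. -/
def unaryCase : Expr → List Stmt → Stmt
  | _, [] => .skip
  | e, st :: sts => .ite e.hd (unaryCase e.pr sts) st

theorem Runs.unaryCase {s s' : Store} {st : Stmt} (sts : List Stmt) :
    ∀ {e : Expr} {q : ℕ}, Evals s e (List.replicate q true ++ [false]) → sts[q]? = some st →
      Runs s st s' → Runs s (unaryCase e sts) s' := by
  induction sts with
  | nil => intro e q _ hq; simp at hq
  | cons a sts ih =>
    intro e q he hq hr
    cases q with
    | zero =>
      obtain rfl : a = st := by simpa using hq
      exact Runs.ite false he.hd hr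
    | succ q => exact Runs.ite true he.hd (ih he.pr (by simpa using hq) hr)

/-! ## Reversing the input -/

/-- Move the first letter of variable `5` to the cells of variable `6`. -/
def readLetter : Stmt :=
  .seq (.ite (Expr.hd (Expr.top (.var 5)))
    (.assign 6 (Expr.push (some true) (.var 6))) (.assign 6 (Expr.push (some false) (.var 6))))
    (.assign 5 (Expr.pr (.var 5)))

/-- The effect of `readLetter`. -/
def readLetterFun (p : Wd × Wd) : Wd × Wd := (p.1.tail, p.1.headD true :: p.2)

/-- Variable `5` holds the first word and variable `6` the cells of the second one. -/
def ReadRep (x : Wd) (p : Wd × Wd) (s : Store) : Prop :=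
  BaseStore x s ∧ s.w 5 = some p.1 ∧ s.w 6 = some (cellsCode (p.2.map some))

theorem readRep (x : Wd) : StoreRep x (ReadRep x) where
  base _ _ h := h.1
  congr _ _ _ h hs := ⟨h.1.congr fun v hv => hs v (by omega),
    (hs 5 (by omega)).trans h.2.1, (hs 6 (by omega)).trans h.2.2⟩

theorem implements_readLetter (x : Wd) : Implements (ReadRep x) 13 readLetter readLetterFun := by
  rintro ⟨l, q⟩ s ⟨h, h₅, h₆⟩
  have e : Evals s (Expr.hd (Expr.top (.var 5))) [l.headD true] := by
    have := ((Evals.var h₅).top h.width).hd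
    rcases l with _ | ⟨a, _ | ⟨b, l⟩⟩ <;> exact this
  refine ⟨(s.updW0 6 (cellsCode ((l.headD true :: q).map some))).updW0 5 l.tail,
    Runs.seq (Runs.ite _ e ?_) (Runs.assign (Evals.var ?_).pr), ⟨?_, ?_, ?_⟩, ?_⟩
  · cases l.headD true <;> exact Runs.assign ((Evals.var h₆).push _)
  · rw [Store.updW0_w, if_neg (by omega), h₅]
  · refine h.congr fun v hv => ?_
    rw [Store.updW0_w, if_neg (by omega), Store.updW0_w, if_neg (by omega)]
  · rfl
  · rfl
  · intro v hv
    rw [Store.updW0_w, if_neg (by omega), Store.updW0_w, if_neg (by omega)]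

theorem iterate_readLetterFun (w q : Wd) :
    readLetterFun^[w.length] (w, q) = ([], w.reverse ++ q) := by
  induction w generalizing q with
  | nil => rfl
  | cons a w ih =>
    rw [List.length_cons, Function.iterate_succ_apply]
    exact (ih (a :: q)).trans (by simp)

/-! ## Pumping cells -/

/-- Move a bit from the cells of variable `src` to variable `dst`, unless the next cell is
blank. -/
def pump (src dst : ℕ) (E : Bool → Expr) : Stmt :=
  .seq (.assign 9 (Expr.top (.var src))) (cellCase fun c => c.elim .skip fun b =>
    .seq (.assign dst (E b)) (.assign src (Expr.pop (.var src))))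

/-- The effect of `pump`. -/
def pumpFun : List (Option Bool) × Wd → List (Option Bool) × Wd
  | (some b :: r, q) => (r, b :: q)
  | p => p

/-- Variable `src` holds cells and variable `dst` the image of a word under `G`. -/
def PumpRep (x : Wd) (src dst : ℕ) (G : Wd → Wd) (p : List (Option Bool) × Wd) (s : Store) : Prop :=
  BaseStore x s ∧ s.w src = some (cellsCode p.1) ∧ s.w dst = some (G p.2)

theorem pumpRep (x : Wd) {src dst : ℕ} (hs : src < 13) (hd : dst < 13) (G : Wd → Wd) :
    StoreRep x (PumpRep x src dst G) where
  base _ _ h := h.1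
  congr _ _ _ h h' := ⟨h.1.congr fun v hv => h' v (by omega),
    (h' src hs).trans h.2.1, (h' dst hd).trans h.2.2⟩

theorem implements_pump (x : Wd) {src dst : ℕ} (hs : src ∈ Set.Ico 5 13) (hd : dst ∈ Set.Ico 5 13)
    (hsd : src ≠ dst) (hs9 : src ≠ 9) (hd9 : dst ≠ 9) {G : Wd → Wd} {E : Bool → Expr}
    (hE : ∀ s b q, s.w dst = some (G q) → Evals s (E b) (G (b :: q))) :
    Implements (PumpRep x src dst G) 13 (pump src dst E) pumpFun := by
  rintro ⟨r, q⟩ s ⟨h, h₁, h₂⟩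
  obtain ⟨hs5, hs13⟩ := hs
  obtain ⟨hd5, hd13⟩ := hd
  obtain ⟨t, ht⟩ := truncW_cellsCode r
  have ha := Runs.assign (x := 9) ((Evals.var h₁).top h.width)
  rw [ht] at ha
  have hb : BaseStore x (s.updW0 9 (cellCode (r.headD none) ++ t)) :=
    h.congr fun v hv => by rw [Store.updW0_w, if_neg (by omega)]
  have h₁' : (s.updW0 9 (cellCode (r.headD none) ++ t)).w src = some (cellsCode r) := by
    rw [Store.updW0_w, if_neg hs9, h₁]
  have h₂' : (s.updW0 9 (cellCode (r.headD none) ++ t)).w dst = some (G q) := by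
    rw [Store.updW0_w, if_neg hd9, h₂]
  have h₉ : (s.updW0 9 (cellCode (r.headD none) ++ t)).w 9 =
    some (cellCode (r.headD none) ++ t) := rfl
  have hv : ∀ v ≥ 13, (s.updW0 9 (cellCode (r.headD none) ++ t)).w v = s.w v := fun v hv => by
    rw [Store.updW0_w, if_neg (by omega)]
  generalize s.updW0 9 (cellCode (r.headD none) ++ t) = s₁ at *
  obtain hr | ⟨b, r, rfl⟩ : r.headD none = none ∨ ∃ b r', r = some b :: r' := by
    rcases r with _ | ⟨_ | b, r⟩
    · exact .inl rfl
    · exact .inl rfl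
    · exact .inr ⟨b, r, rfl⟩
  · refine ⟨s₁, ha.seq (Runs.cellCase h₉ (by rw [hr]; exact Runs.skip _)), ?_, hv⟩
    have : pumpFun (r, q) = (r, q) := by
      rcases r with _ | ⟨_ | b, r⟩
      · rfl
      · rfl
      · simp at hr
    rw [this]
    exact ⟨hb, h₁', h₂'⟩
  · refine ⟨(s₁.updW0 dst (G (b :: q))).updW0 src (cellsCode r), ha.seq (Runs.cellCase h₉
      (Runs.seq (Runs.assign (hE _ _ _ h₂')) (Runs.assign (Evals.pop (cs := some b :: r)
        (Evals.var ?_))))), ⟨?_, ?_, ?_⟩, ?_⟩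
    · rw [Store.updW0_w, if_neg hsd, h₁']
    · refine hb.congr fun v hv => ?_
      rw [Store.updW0_w, if_neg (by omega), Store.updW0_w, if_neg (by omega)]
    · rw [Store.updW0_w, if_pos rfl]
      rfl
    · rw [Store.updW0_w, if_neg hsd.symm, Store.updW0_w, if_pos rfl]
      rfl
    · intro v hv'
      rw [Store.updW0_w, if_neg (by omega), Store.updW0_w, if_neg (by omega), hv v hv']

theorem iterate_pumpFun (r : List (Option Bool)) :
    ∀ (q : Wd) (N : ℕ), (r.takeWhile Option.isSome).length ≤ N →
      (pumpFun^[N] (r, q)).2 = ((r.takeWhile Option.isSome).filterMap id).reverse ++ q := by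
  have hfix : ∀ r q N, r.headD none = none → pumpFun^[N] (r, q) = (r, q) := by
    intro r q N hr
    refine Function.iterate_fixed ?_ N
    rcases r with _ | ⟨_ | b, r⟩
    · rfl
    · rfl
    · simp at hr
  induction r with
  | nil => intro q N _; rw [hfix _ _ _ rfl]; rfl
  | cons c r ih =>
    intro q N hN
    rcases c with _ | b
    · rw [hfix _ _ _ rfl]; rfl
    · simp only [List.takeWhile_cons, Option.isSome_some, if_true, List.length_cons] at hN
      obtain ⟨N, rfl⟩ := Nat.exists_eq_add_of_le' (show 1 ≤ N by omega)
      rw [Function.iterate_succ_apply]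
      refine (ih (b :: q) N (by omega)).trans ?_
      simp

/-! ## Simulating a Turing machine -/

/-- Push the cell `b` on variable `dst`, take the new scanned cell from variable `src` and enter
the state `q`. -/
def moveStmt (src dst : ℕ) (b : Option Bool) (q : ℕ) : Stmt :=
  .seq (.assign dst (Expr.push b (.var dst))) (.seq (.assign 9 (Expr.top (.var src)))
    (.seq (.assign src (Expr.pop (.var src))) (.assign 10 (Expr.unary q))))

/-- Perform the action of a machine without oracles on the configuration held by variables
`7`, `8`, `9` and `10`. -/
def actStmt {n : ℕ} : OTMAct 0 n → Stmt
  | .step b .left q => moveStmt 7 8 b q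
  | .step b .right q => moveStmt 8 7 b q
  | .halt => .skip
  | .query _ _ => .skip

/-- Simulate one step of the machine `M`. -/
def stepStmt (M : OTM 0) : Stmt :=
  unaryCase (.var 10) (List.ofFn fun q => cellCase fun c => actStmt (M.δ q c))

/-- Variables `7`, `8` and `9` hold the tape, and variable `10` the state of a configuration. -/
def ConfigRep (x : Wd) {n : ℕ} (c : Fin n × MTape) (s : Store) : Prop :=
  BaseStore x s ∧ s.w 7 = some (cellsCode c.2.left) ∧ s.w 8 = some (cellsCode c.2.right) ∧
    (∃ t, s.w 9 = some (cellCode c.2.head ++ t)) ∧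
    s.w 10 = some (List.replicate c.1.val true ++ [false])

theorem configRep (x : Wd) (n : ℕ) : StoreRep x (ConfigRep x (n := n)) where
  base _ _ h := h.1
  congr := by
    rintro c s s' ⟨h, h₇, h₈, ⟨t, h₉⟩, h₁₀⟩ hs
    exact ⟨h.congr fun v hv => hs v (by omega), (hs 7 (by omega)).trans h₇,
      (hs 8 (by omega)).trans h₈, ⟨t, (hs 9 (by omega)).trans h₉⟩, (hs 10 (by omega)).trans h₁₀⟩

theorem runs_moveStmt {x : Wd} {s : Store} (h : BaseStore x s) {src dst : ℕ}
    {S D : List (Option Bool)} (hs : src ∈ Set.Ico 5 9) (hd : dst ∈ Set.Ico 5 9) (hsd : src ≠ dst)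
    (hS : s.w src = some (cellsCode S)) (hD : s.w dst = some (cellsCode D)) (b : Option Bool)
    (q : ℕ) :
    ∃ s', Runs s (moveStmt src dst b q) s' ∧ BaseStore x s' ∧
      s'.w src = some (cellsCode S.tail) ∧ s'.w dst = some (cellsCode (b :: D)) ∧
      (∃ t, s'.w 9 = some (cellCode (S.headD none) ++ t)) ∧
      s'.w 10 = some (List.replicate q true ++ [false]) ∧ ∀ v ≥ 13, s'.w v = s.w v := by
  obtain ⟨hs5, hs9⟩ := hs
  obtain ⟨hd5, hd9⟩ := hd
  obtain ⟨t, ht⟩ := truncW_cellsCode S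
  have hS' : (s.updW0 dst (cellsCode (b :: D))).w src = some (cellsCode S) := by
    rw [Store.updW0_w, if_neg hsd, hS]
  have r₁ := Runs.assign (x := dst) ((Evals.var hD).push b)
  have r₂ := Runs.assign (x := 9) ((Evals.var hS').top
    (by rw [Store.updW0_w, if_neg (by omega), h.width]))
  rw [ht] at r₂
  refine ⟨_, r₁.seq (r₂.seq ((Runs.assign (Evals.pop (cs := S) (.var ?_))).seq
    (Runs.assign (Evals.unary _ q)))), ?_, ?_, ?_, ⟨t, ?_⟩, rfl, ?_⟩
  · rw [Store.updW0_w, if_neg (by omega), hS']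
  · refine h.congr fun v hv => ?_
    simp only [Store.updW0_w]
    split_ifs <;> first | omega | rfl
  · simp only [Store.updW0_w]
    split_ifs <;> first | omega | rfl
  · simp only [Store.updW0_w]
    split_ifs <;> first | omega | rfl
  · simp only [Store.updW0_w]
    split_ifs <;> first | omega | rfl
  · intro v hv
    simp only [Store.updW0_w]
    split_ifs <;> first | omega | rfl

theorem implements_stepStmt (x : Wd) (M : OTM 0) :
    Implements (ConfigRep x) 13 (stepStmt M) (M.step1 noOracle) := by
  rintro ⟨q, t⟩ s ⟨h, h₇, h₈, ⟨u, h₉⟩, h₁₀⟩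
  obtain ⟨s', r, h', hv⟩ : ∃ s', Runs s (actStmt (M.δ q t.head)) s' ∧
      ConfigRep x (M.step1 noOracle (q, t)) s' ∧ ∀ v ≥ 13, s'.w v = s.w v := by
    unfold OTM.step1
    dsimp only
    cases M.δ q t.head with
    | halt => exact ⟨s, Runs.skip s, ⟨h, h₇, h₈, ⟨u, h₉⟩, h₁₀⟩, fun _ _ => rfl⟩
    | query i q' => exact i.elim0
    | step b d q' =>
      cases d with
      | left =>
        obtain ⟨s', r, g, g₇, g₈, g₉, g₁₀, hv⟩ := runs_moveStmt h (src := 7) (dst := 8)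
          ⟨by omega, by omega⟩ ⟨by omega, by omega⟩ (by omega) h₇ h₈ b q'.val
        refine ⟨s', r, ?_, hv⟩
        rcases t with ⟨_ | ⟨a, L⟩, c, R⟩ <;> exact ⟨g, g₇, g₈, g₉, g₁₀⟩
      | right =>
        obtain ⟨s', r, g, g₈, g₇, g₉, g₁₀, hv⟩ := runs_moveStmt h (src := 8) (dst := 7)
          ⟨by omega, by omega⟩ ⟨by omega, by omega⟩ (by omega) h₈ h₇ b q'.val
        refine ⟨s', r, ?_, hv⟩
        rcases t with ⟨L, c, _ | ⟨a, R⟩⟩ <;> exact ⟨g, g₇, g₈, g₉, g₁₀⟩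
  refine ⟨s', Runs.unaryCase (st := cellCase fun c => actStmt (M.δ q c)) _ (Evals.var h₁₀) ?_
    (Runs.cellCase (st := fun c => actStmt (M.δ q c)) h₉ r), h', hv⟩
  rw [List.getElem?_ofFn, dif_pos q.isLt]

/-- The number of cells listed in a tape. -/
def MTape.size (t : MTape) : ℕ := t.left.length + 1 + t.right.length

theorem MTape.size_step1_le (M : OTM 0) (c : Fin (M.n + 1) × MTape) :
    (M.step1 noOracle c).2.size ≤ c.2.size + 1 := by
  obtain ⟨q, t⟩ := c
  unfold OTM.step1
  dsimp only
  cases M.δ q t.head with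
  | halt => exact Nat.le_succ _
  | query i q' => exact i.elim0
  | step b d q' =>
    cases d with
    | left =>
      rcases t with ⟨_ | ⟨a, L⟩, c, R⟩ <;>
        simp only [MTape.write, MTape.move, MTape.size, List.length_cons, List.length_nil] <;> omega
    | right =>
      rcases t with ⟨L, c, _ | ⟨a, R⟩⟩ <;>
        simp only [MTape.write, MTape.move, MTape.size, List.length_cons, List.length_nil] <;> omega

theorem MTape.size_iterate_le (M : OTM 0) (m : ℕ) (c : Fin (M.n + 1) × MTape) :
    ((M.step1 noOracle)^[m] c).2.size ≤ c.2.size + m := by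
  induction m with
  | zero => exact le_rfl
  | succ m ih =>
    rw [Function.iterate_succ_apply']
    exact (MTape.size_step1_le M _).trans (by omega)

theorem OTM.Outputs.iterate {M : OTM 0} {inp out : Wd} {T : ℕ}
    (h : M.Outputs noOracle inp out T) :
    ((M.step1 noOracle)^[T] (0, MTape.init inp)).2.wordAt = out := by
  obtain ⟨m, hm, hh, ho⟩ := h
  obtain ⟨k, rfl⟩ := Nat.exists_eq_add_of_le' hm
  rw [Function.iterate_add_apply, Function.iterate_fixed _ k]
  · exact ho
  · generalize (M.step1 noOracle)^[m] (0, MTape.init inp) = c at hh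
    unfold OTM.isHalt at hh
    unfold OTM.step1
    rw [hh]

/-! ## The simulating procedure -/

/-- `st` leads from stores satisfying `A` to stores satisfying `B`. -/
def Leads (A : Store → Prop) (st : Stmt) (B : Store → Prop) : Prop :=
  ∀ s, A s → ∃ s', Runs s st s' ∧ B s'

theorem Leads.seq {A B C : Store → Prop} {st st' : Stmt} (h : Leads A st B) (h' : Leads B st' C) :
    Leads A (.seq st st') C := fun s hs => by
  obtain ⟨s₁, r₁, h₁⟩ := h s hs
  obtain ⟨s₂, r₂, h₂⟩ := h' s₁ h₁
  exact ⟨s₂, r₁.seq r₂, h₂⟩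

theorem leads_polyLoop {x : Wd} {α : Type*} {Rep : α → Store → Prop} (hR : StoreRep x Rep)
    {body : Stmt} {f : α → α} (h : Implements Rep 13 body f) (Q : SOP 0 1) (a : α) :
    Leads (Rep a) (polyLoop Q 13 body) (Rep (f^[Q.eval noOSize fun _ => x.length] a)) :=
  fun s hs => by
    obtain ⟨s', r, h', _⟩ := h.polyLoop hR Q le_rfl a s hs
    exact ⟨s', r, h'⟩

/-- Initialize the variables from `1` to `6`. -/
def initStmt : Stmt :=
  .seq (.assign 1 (.suc false (.suc false .eps)))
    (.seq (.assign 2 (.oracleCall 0 (.pr (.oracleCall 0 .eps (.var 0))) (.var 0)))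
    (.seq (.assign 3 (.suc true .eps)) (.seq (.assign 4 (.suc false .eps))
    (.seq (.assign 5 (.var 0)) (.assign 6 .eps)))))

theorem leads_initStmt (x : Wd) :
    Leads (fun s => s.w 0 = some x) initStmt (ReadRep x (x, [])) := by
  intro s hs
  have e : truncW (truncW [] x).tail x = List.replicate x.length false ++ [true] := by
    simp [truncW, truncN]
  refine ⟨_, Runs.seq (Runs.assign (((Evals.eps s).suc false).suc false))
    (Runs.seq (Runs.assign ((((Evals.eps _).oracle (Evals.var (v := x) ?_)).pr).oracle
      (Evals.var (v := x) ?_)))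
    (Runs.seq (Runs.assign ((Evals.eps _).suc true)) (Runs.seq (Runs.assign
    ((Evals.eps _).suc false)) (Runs.seq (Runs.assign (Evals.var (v := x) ?_))
    (Runs.assign (Evals.eps _)))))), ⟨?_, rfl, ?_, rfl, rfl⟩, rfl, rfl⟩
  · exact hs
  · exact hs
  · exact hs
  · exact hs
  · rw [← e]
    rfl

/-- Code the encoding of the input as cells in variable `8`. -/
def encodeStmt : Stmt :=
  .seq (.assign 8 (.push (some false) (.push (some false) .eps)))
    (polyLoop (.var 0) 13 (pump 6 8 fun b => .push (some true) (.push (some b) (.var 8))))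

theorem filterMap_takeWhile_map_some (w : Wd) :
    ((w.map some).takeWhile Option.isSome).filterMap id = w := by
  induction w with
  | nil => rfl
  | cons a w ih => simpa using ih

theorem leads_encodeStmt (x : Wd) : Leads (ReadRep x ([], x.reverse)) encodeStmt
    (fun s => BaseStore x s ∧ s.w 8 = some (cellsCode ((encTuple [x]).map some))) := by
  refine Leads.seq (B := PumpRep x 6 8
    (fun q => cellsCode ((bitPairs q ++ [false, false]).map some)) (x.reverse.map some, [])) ?_ ?_
  · rintro s ⟨h, -, h₆⟩
    refine ⟨_, Runs.assign (Evals.push (cs := [some false]) _ (Evals.push (cs := []) _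
      (Evals.eps s))), h.congr fun v hv => ?_, h₆, rfl⟩
    rw [Store.updW0_w, if_neg (by omega)]
  · intro s hs
    obtain ⟨s', r, h, -, h₈⟩ := leads_polyLoop (pumpRep x (by omega) (by omega) _)
      (implements_pump x ⟨by omega, by omega⟩ ⟨by omega, by omega⟩ (by omega) (by omega) (by omega)
        (fun s b q hq => Evals.push (cs := some b :: (bitPairs q ++ [false, false]).map some) _
          (Evals.push _ (Evals.var hq)))) (.var 0) _ s hs
    refine ⟨s', r, h, ?_⟩
    rw [h₈, encTuple_singleton, iterate_pumpFun, filterMap_takeWhile_map_some]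
    · simp
    · refine (List.takeWhile_prefix _).length_le.trans ?_
      simp [SOP.eval]

/-- Run the machine `M` on the cells in variable `8`. -/
def simulateStmt (M : OTM 0) (P : SOP 0 1) : Stmt :=
  .seq (.seq (.assign 9 (.top (.var 8))) (.seq (.assign 8 (.pop (.var 8)))
    (.seq (.assign 7 .eps) (.assign 10 (.unary 0))))) (polyLoop P 13 (stepStmt M))

theorem leads_simulateStmt (M : OTM 0) (P : SOP 0 1) (x w : Wd) :
    Leads (fun s => BaseStore x s ∧ s.w 8 = some (cellsCode (w.map some))) (simulateStmt M P)
      (ConfigRep x ((M.step1 noOracle)^[P.eval noOSize fun _ => x.length] (0, MTape.init w))) := by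
  refine Leads.seq ?_ (leads_polyLoop (configRep x _) (implements_stepStmt x M) P _)
  rintro s ⟨h, h₈⟩
  obtain ⟨t, ht⟩ := truncW_cellsCode (w.map some)
  have r := Runs.assign (x := 9) ((Evals.var h₈).top h.width)
  rw [ht] at r
  refine ⟨_, r.seq (Runs.seq (Runs.assign (Evals.pop (cs := w.map some) (Evals.var ?_)))
    (Runs.seq (Runs.assign (Evals.eps _)) (Runs.assign (Evals.unary _ 0)))), ?_, rfl, ?_,
    ⟨t, ?_⟩, rfl⟩
  · exact h₈
  · refine h.congr fun v hv => ?_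
    simp only [Store.updW0_w]
    split_ifs <;> first | omega | rfl
  · change some (cellsCode (w.map some).tail) = some (cellsCode (w.tail.map some))
    rw [List.map_tail]
  · cases w <;> rfl

/-- A bound for the number of cells used by a machine running in time `P`. -/
def SOP.space (P : SOP 0 1) : SOP 0 1 := .add P (.add (.var 0) (.add (.var 0) (.const 3)))

/-- Write the output word of the machine to variable `12`. -/
def outputStmt (P : SOP 0 1) : Stmt :=
  .seq (.seq (cellCase fun c => .assign 8 (.push c (.var 8))) (.assign 11 .eps))
    (.seq (polyLoop P.space 13 (pump 8 11 fun b => .push (some b) (.var 11)))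
    (.seq (.assign 12 .eps) (polyLoop P.space 13 (pump 11 12 fun b => .suc b (.var 12)))))

theorem leads_outputStmt (P : SOP 0 1) (x : Wd) {n : ℕ} (c : Fin n × MTape)
    (hc : c.2.size ≤ P.space.eval noOSize fun _ => x.length) :
    Leads (ConfigRep x c) (outputStmt P) (fun s => s.w 12 = some c.2.wordAt) := by
  have hlen : ((c.2.head :: c.2.right).takeWhile Option.isSome).length ≤
      P.space.eval noOSize fun _ => x.length := by
    refine ((List.takeWhile_prefix _).length_le.trans ?_).trans hc
    simp only [List.length_cons, MTape.size]
    omega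
  have hout : ((c.2.head :: c.2.right).takeWhile Option.isSome).filterMap id = c.2.wordAt := rfl
  have hwlen : c.2.wordAt.length ≤ P.space.eval noOSize fun _ => x.length :=
    (List.length_filterMap_le _ _).trans hlen
  refine Leads.seq (B := PumpRep x 8 11 (fun q => cellsCode (q.map some))
    (c.2.head :: c.2.right, [])) ?_ (Leads.seq (leads_polyLoop (pumpRep x (by omega) (by omega) _)
      (implements_pump x ⟨by omega, by omega⟩ ⟨by omega, by omega⟩ (by omega) (by omega) (by omega)
        (fun s b q hq => Evals.push (cs := q.map some) _ (Evals.var hq))) P.space _)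
      (Leads.seq (B := PumpRep x 11 12 id (c.2.wordAt.reverse.map some, [])) ?_ ?_))
  · rintro s ⟨h, -, h₈, ⟨t, h₉⟩, -⟩
    refine ⟨_, Runs.seq (Runs.cellCase h₉ (Runs.assign ((Evals.var h₈).push _)))
      (Runs.assign (Evals.eps _)), h.congr fun v hv => ?_, rfl, rfl⟩
    simp only [Store.updW0_w]
    split_ifs <;> first | omega | rfl
  · rintro s ⟨h, -, h₁₁⟩
    refine ⟨_, Runs.assign (Evals.eps s), h.congr fun v hv => ?_, ?_, rfl⟩
    · rw [Store.updW0_w, if_neg (by omega)]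
    · rw [Store.updW0_w, if_neg (by omega), h₁₁, iterate_pumpFun _ _ _ hlen, hout,
        List.append_nil]
  · intro s hs
    obtain ⟨s', r, -, -, h⟩ := leads_polyLoop (pumpRep x (by omega) (by omega) _)
      (implements_pump x ⟨by omega, by omega⟩ ⟨by omega, by omega⟩ (by omega) (by omega) (by omega)
        (fun s b q hq => (Evals.var hq).suc b)) P.space _ s hs
    refine ⟨s', r, ?_⟩
    change s'.w 12 = _
    rw [h, iterate_pumpFun, filterMap_takeWhile_map_some]
    · simp
    · refine (List.takeWhile_prefix _).length_le.trans ?_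
      simpa using hwlen

/-- Simulate the machine `M` with running time `P` on the input in variable `0`. -/
def mainStmt (M : OTM 0) (P : SOP 0 1) : Stmt :=
  .seq initStmt (.seq (polyLoop (.var 0) 13 readLetter)
    (.seq encodeStmt (.seq (simulateStmt M P) (outputStmt P))))

theorem leads_mainStmt {M : OTM 0} {P : SOP 0 1} {x w : Wd}
    (h : M.Outputs noOracle (encTuple [x]) w (P.eval noOSize fun _ => x.length)) :
    Leads (fun s => s.w 0 = some x) (mainStmt M P) (fun s => s.w 12 = some w) := by
  have h₂ := leads_polyLoop (readRep x) (implements_readLetter x) (.var 0) (x, [])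
  rw [SOP.eval, iterate_readLetterFun, List.append_nil] at h₂
  have h₅ := leads_outputStmt P x
    ((M.step1 noOracle)^[P.eval noOSize fun _ => x.length] (0, MTape.init (encTuple [x]))) ?_
  · rw [h.iterate] at h₅
    exact (leads_initStmt x).seq (h₂.seq ((leads_encodeStmt x).seq
      ((leads_simulateStmt M P x (encTuple [x])).seq h₅)))
  · refine (MTape.size_iterate_le M _ _).trans ?_
    simp only [MTape.size, MTape.init, SOP.space, SOP.eval, List.length_map, List.length_tail,
      List.length_nil, encTuple_singleton, List.length_append, bitPairs_length, List.length_cons]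
    omega

/-! ## Typing the simulating procedure -/

/-- The operator typing environment allowing every safe tier for the operators `0` to `4`. -/
def mainOTE : OTE := fun o k =>
  { p | o ≤ 4 ∧ p.1.length = opArity o ∧ (∀ ki ∈ p.1, p.2 ≤ ki ∧ ki ≤ k) ∧
    (o = 2 ∨ o = 3 → p.2 < k) }

/-- The variables from `5` to `12` have tier `0`, the other ones tier `1`. -/
def mainVEnv : VEnv := fun v => some (if 5 ≤ v ∧ v < 13 then 0 else 1)

theorem mainVEnv_zero {v : ℕ} (h : 5 ≤ v) (h' : v < 13) : mainVEnv v = some 0 := by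
  simp [mainVEnv, h, h']

theorem mainVEnv_one {v : ℕ} (h : v < 5 ∨ 13 ≤ v) : mainVEnv v = some 1 := by
  rw [mainVEnv, if_neg (by omega)]

theorem neutralOp_of_subword {o : ℕ} (ho : opArity o = 1)
    (h : ∀ w, Subword (opSem o [w]) w) : NeutralOp o := by
  refine .inr (.inr fun ws hws => ?_)
  obtain ⟨w, rfl⟩ := List.length_eq_one_iff.mp (hws.trans ho)
  exact ⟨w, by simp, h w⟩

theorem safeOTE_mainOTE : SafeOTE mainOTE := by
  rintro o k ks k' ⟨ho, hlen, hks, hpos⟩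
  have neutral_pred : NeutralOp 1 := neutralOp_of_subword rfl fun w => by
    cases w with
    | nil => exact ⟨[], [], rfl⟩
    | cons a w => exact ⟨[a], [], by simp [opSem]⟩
  have neutral_head : NeutralOp 4 := neutralOp_of_subword rfl fun w =>
    ⟨[], w.drop 1, (List.take_append_drop 1 w).symm⟩
  have positive : ∀ b : Bool, PositiveOp (if b then 3 else 2) := fun b => by
    refine ⟨1, fun ws => ?_⟩
    cases b <;> cases ws <;> simp [opSem]
  have hin : InFP (opArity o) (opSem o) := by
    interval_cases o
    · exact inFP_eps
    · exact inFP_pred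
    · exact inFP_suc0
    · exact inFP_suc1
    · exact inFP_head
  have hn : o = 2 ∨ o = 3 ∨ NeutralOp o := by
    interval_cases o
    · exact .inr (.inr (.inl rfl))
    · exact .inr (.inr neutral_pred)
    · exact .inl rfl
    · exact .inr (.inl rfl)
    · exact .inr (.inr neutral_head)
  refine ⟨?_, hin, hlen, hks, fun h => hpos (by tauto)⟩
  rcases hn with rfl | rfl | hn
  · exact .inr (positive false)
  · exact .inr (positive true)
  · exact .inl hn

/-- `e` has tier `0` in every context. -/
def LowExpr (e : Expr) : Prop := ∀ kin ≥ 1, TyExpr mainVEnv mainOTE e (0, kin, 1)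

/-- `st` has tier `0` in every context. -/
def LowStmt (st : Stmt) : Prop := ∀ kin ≥ 1, TyStmt mainVEnv mainOTE st (0, kin, 1)

/-- `st` has tier `1` in every context. -/
def HighStmt (st : Stmt) : Prop := ∀ kin ≥ 1, TyStmt mainVEnv mainOTE st (1, kin, 1)

theorem LowStmt.high {st : Stmt} (h : LowStmt st) : HighStmt st :=
  fun kin hk => .ssub (h kin hk)

theorem tyExpr_op_one {o k kin kout : ℕ} {e : Expr} (ho : o ≤ 4) (ha : opArity o = 1)
    (hk : k ≤ kin) (hpos : o = 2 ∨ o = 3 → k < kin)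
    (h : TyExpr mainVEnv mainOTE e (k, kin, kout)) :
    TyExpr mainVEnv mainOTE (.op o [e]) (k, kin, kout) := by
  refine .eop (ks := [k]) ⟨ho, ha.symm, by simpa using hk, hpos⟩ rfl ?_
  rintro (_ | i) κ e' hκ he
  · simp only [List.getElem?_cons_zero, Option.some.injEq] at hκ he
    subst hκ he
    exact h
  · simp at he

theorem tyExpr_eps (k kin kout : ℕ) (h : k < kin) :
    TyExpr mainVEnv mainOTE .eps (k, kin, kout) :=
  .eop (ks := []) ⟨by omega, rfl, by simp, fun _ => h⟩ rfl (by simp)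

theorem LowExpr.eps : LowExpr .eps := fun kin hk => tyExpr_eps 0 kin 1 hk

theorem LowExpr.var {v : ℕ} (h : 5 ≤ v) (h' : v < 13) : LowExpr (.var v) :=
  fun _ _ => .evar (mainVEnv_zero h h')

theorem LowExpr.suc {e : Expr} (b : Bool) (h : LowExpr e) : LowExpr (e.suc b) := fun kin hk =>
  tyExpr_op_one (by cases b <;> decide) (by cases b <;> rfl) (Nat.zero_le _) (fun _ => hk)
    (h kin hk)

theorem LowExpr.pr {e : Expr} (h : LowExpr e) : LowExpr e.pr := fun kin hk =>
  tyExpr_op_one (by omega) rfl (Nat.zero_le _) (by omega) (h kin hk)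

theorem LowExpr.hd {e : Expr} (h : LowExpr e) : LowExpr e.hd := fun kin hk =>
  tyExpr_op_one (by omega) rfl (Nat.zero_le _) (by omega) (h kin hk)

theorem LowExpr.top {e : Expr} (h : LowExpr e) : LowExpr e.top := fun kin hk =>
  .eor (h kin hk) (.evar (mainVEnv_one (by omega))) hk (by omega)

theorem LowExpr.push {e : Expr} (c : Option Bool) (h : LowExpr e) : LowExpr (e.push c) := by
  cases c with
  | none => exact (h.suc false).suc true
  | some b => exact (h.suc b).suc false

theorem LowExpr.pop {e : Expr} (h : LowExpr e) : LowExpr e.pop := h.pr.pr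

theorem LowExpr.unary (q : ℕ) : LowExpr (.unary q) := by
  induction q with
  | zero => exact LowExpr.eps.suc false
  | succ q ih =>
    rw [Expr.unary, Function.iterate_succ_apply']
    exact ih.suc true

theorem LowStmt.skip : LowStmt .skip := fun _ _ => .ssk

theorem LowStmt.assign {v : ℕ} {e : Expr} (h : 5 ≤ v) (h' : v < 13) (he : LowExpr e) :
    LowStmt (.assign v e) := fun kin hk => .sasg (mainVEnv_zero h h') (he kin hk) le_rfl

theorem LowStmt.seq {st st' : Stmt} (h : LowStmt st) (h' : LowStmt st') : LowStmt (.seq st st') :=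
  fun kin hk => .sseq (h kin hk) (h' kin hk)

theorem LowStmt.ite {e : Expr} {st st' : Stmt} (he : LowExpr e) (h : LowStmt st)
    (h' : LowStmt st') : LowStmt (.ite e st st') :=
  fun kin hk => .scnd (he kin hk) (h kin hk) (h' kin hk)

theorem LowStmt.cellCase {st : Option Bool → Stmt} (h : ∀ c, LowStmt (st c)) :
    LowStmt (cellCase st) :=
  have h₉ : LowExpr (.var 9) := .var (by omega) (by omega)
  .ite h₉.hd (h _) (.ite h₉.pr.hd (h _) (h _))

theorem LowStmt.unaryCase {sts : List Stmt} (h : ∀ st ∈ sts, LowStmt st) :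
    ∀ {e : Expr}, LowExpr e → LowStmt (unaryCase e sts) := by
  induction sts with
  | nil => exact fun _ => .skip
  | cons a sts ih =>
    exact fun he => .ite he.hd (ih (fun st hst => h st (List.mem_cons_of_mem _ hst)) he.pr)
      (h a List.mem_cons_self)

theorem HighStmt.seq {st st' : Stmt} (h : HighStmt st) (h' : HighStmt st') :
    HighStmt (.seq st st') := fun kin hk => .sseq (h kin hk) (h' kin hk)

theorem HighStmt.assign {v : ℕ} {e : Expr} (h : v < 5 ∨ 13 ≤ v)
    (he : ∀ kin ≥ 1, TyExpr mainVEnv mainOTE e (1, kin, 1)) : HighStmt (.assign v e) :=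
  fun kin hk => .sasg (mainVEnv_one h) (he kin hk) le_rfl

theorem HighStmt.loopGuard {b : ℕ} (hb : 13 ≤ b) : HighStmt (loopGuard b) := fun kin hk =>
  .scnd (tyExpr_op_one (by omega) rfl hk (by omega) (.evar (mainVEnv_one (by omega))))
    (HighStmt.assign (by omega) (fun _ _ => .evar (mainVEnv_one (by omega))) kin hk)
    (HighStmt.assign (by omega) (fun _ _ => .evar (mainVEnv_one (by omega))) kin hk)

theorem HighStmt.inputLoop {b : ℕ} (hb : 13 ≤ b) {body : Stmt} (h : HighStmt body) :
    HighStmt (inputLoop b body) :=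
  (HighStmt.assign (by omega) fun _ _ => .evar (mainVEnv_one (by omega))).seq
    ((HighStmt.loopGuard hb).seq fun _ _ => .swh (.evar (mainVEnv_one (by omega)))
      ((HighStmt.assign (by omega) fun _ hk => tyExpr_op_one (by omega) rfl hk (by omega)
        (.evar (mainVEnv_one (by omega)))).seq (h.seq (HighStmt.loopGuard hb)) 1 le_rfl)
      le_rfl le_rfl)

theorem HighStmt.polyLoop (Q : SOP 0 1) :
    ∀ {b : ℕ}, 13 ≤ b → ∀ {body : Stmt}, HighStmt body → HighStmt (polyLoop Q b body) := by
  induction Q with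
  | const k =>
    intro b hb body h
    change HighStmt ((Stmt.seq body)^[k] .skip)
    induction k with
    | zero => exact LowStmt.skip.high
    | succ k ih =>
      rw [Function.iterate_succ_apply']
      exact h.seq ih
  | var j => exact fun hb _ h => h.inputLoop hb
  | app i p => exact i.elim0
  | add p q ihp ihq => exact fun hb _ h => (ihp hb h).seq (ihq hb h)
  | mul p q ihp ihq => exact fun hb _ h => ihp (by omega) (ihq hb h)

theorem LowStmt.readLetter : LowStmt readLetter :=
  have h₅ : LowExpr (.var 5) := .var (by omega) (by omega)
  have h₆ : LowExpr (.var 6) := .var (by omega) (by omega)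
  .seq (.ite h₅.top.hd (.assign (by omega) (by omega) (h₆.push _))
    (.assign (by omega) (by omega) (h₆.push _))) (.assign (by omega) (by omega) h₅.pr)

theorem LowStmt.pump {src dst : ℕ} {E : Bool → Expr} (hs : src ∈ Set.Ico 5 13)
    (hd : dst ∈ Set.Ico 5 13) (hE : ∀ b, LowExpr (E b)) : LowStmt (pump src dst E) := by
  have h := LowExpr.var hs.1 hs.2
  refine .seq (.assign (by omega) (by omega) h.top) (.cellCase ?_)
  rintro (_ | b)
  · exact .skip
  · exact .seq (.assign hd.1 hd.2 (hE b)) (.assign hs.1 hs.2 h.pop)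

theorem LowStmt.moveStmt {src dst : ℕ} (hs : src ∈ Set.Ico 5 13) (hd : dst ∈ Set.Ico 5 13)
    (b : Option Bool) (q : ℕ) : LowStmt (moveStmt src dst b q) :=
  have h := LowExpr.var hs.1 hs.2
  .seq (.assign hd.1 hd.2 ((LowExpr.var hd.1 hd.2).push b)) (.seq
    (.assign (by omega) (by omega) h.top) (.seq (.assign hs.1 hs.2 h.pop)
    (.assign (by omega) (by omega) (.unary q))))

theorem LowStmt.actStmt {n : ℕ} (a : OTMAct 0 n) : LowStmt (actStmt a) := by
  rcases a with _ | ⟨b, _ | _, q⟩ | ⟨i, q⟩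
  · exact .skip
  · exact .moveStmt ⟨by omega, by omega⟩ ⟨by omega, by omega⟩ b q
  · exact .moveStmt ⟨by omega, by omega⟩ ⟨by omega, by omega⟩ b q
  · exact .skip

theorem LowStmt.stepStmt (M : OTM 0) : LowStmt (stepStmt M) := by
  refine .unaryCase (fun st hst => ?_) (.var (by omega) (by omega))
  obtain ⟨q, rfl⟩ := (List.mem_ofFn' _ _).mp hst
  exact .cellCase fun c => .actStmt _

theorem tyStmt_initStmt : TyStmt mainVEnv mainOTE initStmt (1, 2, 1) := by
  have v : ∀ {x : ℕ}, x < 5 → mainVEnv x = some 1 := fun h => mainVEnv_one (.inl h)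
  have eps := tyExpr_eps 1 2 1 (by omega)
  have suc : ∀ (b : Bool) {e : Expr}, TyExpr mainVEnv mainOTE e (1, 2, 1) →
      TyExpr mainVEnv mainOTE (e.suc b) (1, 2, 1) := fun b _ h =>
    tyExpr_op_one (by cases b <;> decide) (by cases b <;> rfl) (by omega) (by omega) h
  have x : TyExpr mainVEnv mainOTE (.var 0) (1, 2, 1) := .evar (v (by omega))
  refine .sseq (.sasg (v (by omega)) (suc _ (suc _ eps)) le_rfl) (.sseq (.sasg (v (by omega))
    (.eor (tyExpr_op_one (by omega) rfl (by omega) (by omega)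
      (.eor eps x (by omega) le_rfl)) x (by omega) le_rfl) le_rfl)
    (.sseq (.sasg (v (by omega)) (suc _ eps) le_rfl) (.sseq (.sasg (v (by omega)) (suc _ eps) le_rfl)
    (.sseq (.ssub (.sasg (mainVEnv_zero (by omega) (by omega)) x (by omega)))
    ((LowStmt.assign (by omega) (by omega) .eps).high 2 (by omega))))))

theorem highStmt_encodeStmt : HighStmt encodeStmt :=
  (LowStmt.assign (by omega) (by omega) ((LowExpr.eps.push _).push _)).high.seq
    (.polyLoop _ le_rfl (LowStmt.pump ⟨by omega, by omega⟩ ⟨by omega, by omega⟩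
      fun _ => ((LowExpr.var (by omega) (by omega)).push _).push _).high)

theorem highStmt_simulateStmt (M : OTM 0) (P : SOP 0 1) : HighStmt (simulateStmt M P) :=
  have h₈ : LowExpr (.var 8) := .var (by omega) (by omega)
  (LowStmt.seq (.assign (by omega) (by omega) h₈.top) (.seq
    (.assign (by omega) (by omega) h₈.pop) (.seq (.assign (by omega) (by omega) .eps)
    (.assign (by omega) (by omega) (.unary 0))))).high.seq
    (.polyLoop P le_rfl (LowStmt.stepStmt M).high)

theorem highStmt_outputStmt (P : SOP 0 1) : HighStmt (outputStmt P) :=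
  (LowStmt.seq (.cellCase fun c => .assign (by omega) (by omega)
    ((LowExpr.var (by omega) (by omega)).push c)) (.assign (by omega) (by omega) .eps)).high.seq
    (.seq (.polyLoop _ le_rfl (LowStmt.pump ⟨by omega, by omega⟩ ⟨by omega, by omega⟩
      fun _ => (LowExpr.var (by omega) (by omega)).push _).high)
    (.seq (LowStmt.assign (by omega) (by omega) .eps).high
    (.polyLoop _ le_rfl (LowStmt.pump ⟨by omega, by omega⟩ ⟨by omega, by omega⟩
      fun _ => (LowExpr.var (by omega) (by omega)).suc _).high)))

theorem tyStmt_mainStmt (M : OTM 0) (P : SOP 0 1) :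
    TyStmt mainVEnv mainOTE (mainStmt M P) (1, 2, 1) :=
  .sseq tyStmt_initStmt ((HighStmt.polyLoop (.var 0) le_rfl LowStmt.readLetter.high).seq
    (highStmt_encodeStmt.seq ((highStmt_simulateStmt M P).seq (highStmt_outputStmt P))) 2
    (by omega))

/-! ## The simulating program -/

/-- The procedure simulating `M` with running time `P`. -/
def mainProc (M : OTM 0) (P : SOP 0 1) : Proc where
  name := 0
  oparams := [0]
  params := [0]
  locals := []
  body := mainStmt M P
  ret := 12

/-- The call of `mainProc` on the variable `0` and the closure of the identity. -/
def mainCall : Tm := .call 0 [(0, .var (.v0 0))] [.var (.v0 0)]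

theorem mainProg_mem_SAFEr (M : OTM 0) (P : SOP 0 1) :
    Prog.box (.v0 0) (.declare [mainProc M P] (.term mainCall)) ∈ SAFEr 0 := by
  refine ⟨mainOTE, safeOTE_mainOTE, fun _ => none, fun _ => (mainVEnv, 1, 2, 1), .arrow .W .W,
    .pbox (.pdec ?_ (.pterm (.pcall (p := mainProc M P) (by simp) rfl rfl rfl ?_ ?_))),
    ⟨0, 1, rfl⟩⟩
  · intro p hp
    obtain rfl := List.mem_singleton.mp hp
    exact tyStmt_mainStmt M P
  · intro c hc
    obtain rfl := List.mem_singleton.mp hc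
    exact .pvar (by simp [TEnv.upd])
  · intro t ht
    obtain rfl := List.mem_singleton.mp ht
    exact .pvar (by simp [TEnv.upd])

theorem evalTm_mainCall {M : OTM 0} {P : SOP 0 1} {x w : Wd} {s : Store} (hs : s.w 0 = some x)
    (h : M.Outputs noOracle (encTuple [x]) w (P.eval noOSize fun _ => x.length)) :
    EvalTm [mainProc M P] s mainCall w := by
  obtain ⟨s', r, hw⟩ := leads_mainStmt h (s.updW0 0 x) rfl
  refine .call (p := mainProc M P) [x] (.val (.call _ _ _)) (by simp) rfl rfl rfl rfl ?_
    (r [mainProc M P]) hw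
  rintro (_ | i) t v ht hv
  · simp only [List.getElem?_cons_zero, Option.some.injEq] at ht hv
    subst ht hv
    exact .tvar (.val (.var0 0)) hs
  · simp at ht

/-- For any polynomial-time Turing machine `M` (computing the function
`g` within a polynomial time bound `P`), there exists a program in `SAFE₀` that computes
the same function as `M`. -/
theorem polytime_TM_computable_in_SAFE0 (M : OTM 0) (P : SOP 0 1) (g : Wd → Wd)
    (hM : ∀ x : Wd,
      M.Outputs noOracle (encTuple [x]) (g x) (P.eval noOSize (fun _ => x.length))) :
    ∃ prg ∈ SAFEr 0, computesTotal prg 0 1 (fun _ ws => g (ws 0)) := by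
  refine ⟨_, mainProg_mem_SAFEr M P, [], [0], [mainProc M P], mainCall, rfl, rfl, by simp, by simp,
    rfl, fun fs ws => ?_⟩
  have h₀ : (initStore [] [0] (List.ofFn fs) (List.ofFn ws)).w 0 = some (ws 0) := by
    simp [initStore]
  refine .box ?_ (.dec (.term (evalTm_mainCall h₀ (hM (ws 0)))))
  change ((initStore [] [0] (List.ofFn fs) (List.ofFn ws)).w 0).isSome
  rw [h₀]
  rfl
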